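/- Let μ_j = σ√(log(2p/j)/n) for j = 1,…,p and let |u|_* = ∑_{j=1}^p μ_j u_j* be the SLOPE norm. Let f ∈ ℝⁿ, ξ ∼ N(0, σ²I_{n×n}), y = f + ξ, assume the diagonal elements of (1/n)𝕏ᵀ𝕏 are at most 1, and let A ≥ 8. Let β̂ be any solution of min_{β∈ℝᵖ}( ‖y − 𝕏β‖² + 2A|β|_* ). Then for all δ ∈ (0,1), with probability at least 1 − δ, ‖𝕏β̂ − f‖ ≤ min over s ∈ {1,…,p} of [ min_{β: |β|₀ ≤ s} ‖𝕏β − f‖ + (3σA/(2ϑ(s,3)))√(s log(2ep/s)/n) ] + σΦ⁻¹(1−δ)/√n; moreover E‖𝕏β̂ − f‖ ≤ min over s ∈ {1,…,p} of [ min_{β: |β|₀ ≤ s} ‖𝕏β − f‖ + (3σA/(2ϑ(s,3)))√(s log(2ep/s)/n) ] + σ/√(2πn), with the convention a/0 = +∞ for a > 0. -/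

import Mathlib

open MeasureTheory ProbabilityTheory
open scoped ENNReal

/-- The scaled Euclidean norm `‖u‖ = sqrt((1/n) ∑ u_i²)` on `ℝⁿ`. -/
noncomputable def scaledNorm {n : ℕ} (u : Fin n → ℝ) : ℝ :=
  Real.sqrt ((∑ i, u i ^ 2) / n)

/-- The standard normal cumulative distribution function `Φ`. -/
noncomputable def stdPhi (t : ℝ) : ℝ :=
  (gaussianReal 0 1 (Set.Iic t)).toReal

/-- The Gaussian measure `N(0, σ²I_{n×n})` on `ℝⁿ` (i.i.d. `N(0,σ²)` components). -/
noncomputable def gaussianVec (n : ℕ) (σ : ℝ) : Measure (Fin n → ℝ) :=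
  Measure.pi fun _ : Fin n => gaussianReal 0 ⟨σ ^ 2, sq_nonneg σ⟩

/-- `rearr u j` is the `(j+1)`-th largest value among `|u₁|,…,|u_p|`
(the non-increasing rearrangement `u*`, `0`-indexed). -/
noncomputable def rearr {p : ℕ} (u : Fin p → ℝ) (j : Fin p) : ℝ :=
  ((Finset.univ.val.map fun i => |u i|).sort (· ≥ ·)).getD j 0

/-- The SLOPE weights `μ_j = σ √(log(2p/j)/n)` (`0`-indexed: `j+1` plays the role of `j`). -/
noncomputable def muW (σ : ℝ) (n : ℕ) {p : ℕ} (j : Fin p) : ℝ :=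
  σ * Real.sqrt (Real.log (2 * p / ((j : ℕ) + 1)) / n)

/-- The SLOPE norm `|u|_* = ∑_j μ_j u_j*`. -/
noncomputable def slopeNorm (σ : ℝ) (n : ℕ) {p : ℕ} (u : Fin p → ℝ) : ℝ :=
  ∑ j, muW σ n j * rearr u j

/-- The squared Weighted Restricted Eigenvalue constant `ϑ²(s,c₀)`. -/
noncomputable def thetaSq {n p : ℕ} (X : Matrix (Fin n) (Fin p) ℝ) (σ : ℝ)
    (s : ℕ) (c₀ : ℝ) : ℝ :=
  sInf {r | ∃ Δ : Fin p → ℝ, Δ ≠ 0 ∧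
    (∑ j ∈ Finset.univ.filter (fun j : Fin p => s ≤ (j : ℕ)), muW σ n j * rearr Δ j)
      ≤ c₀ * Real.sqrt (∑ j ∈ Finset.univ.filter (fun j : Fin p => (j : ℕ) < s),
            muW σ n j ^ 2) * Real.sqrt (∑ j, Δ j ^ 2) ∧
    r = scaledNorm (X.mulVec Δ) ^ 2 / ∑ j, Δ j ^ 2}

/-- A continuous integrable function is the derivative of its primitive from `-∞`. -/
theorem hasDerivAt_setIntegral_Iic {w : ℝ → ℝ} (hc : Continuous w) (hi : Integrable w) (y : ℝ) :
    HasDerivAt (fun y => ∫ t in Set.Iic y, w t) (w y) y := by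
  have h : (fun y => ∫ t in Set.Iic y, w t) =
      fun y => (∫ t in Set.Iic 0, w t) + ∫ t in (0:ℝ)..y, w t := by
    funext y
    rw [← intervalIntegral.integral_Iic_sub_Iic hi.integrableOn hi.integrableOn]
    ring
  rw [h]
  exact (intervalIntegral.integral_hasDerivAt_right (hc.intervalIntegrable _ _)
    (hc.stronglyMeasurableAtFilter _ _) hc.continuousAt).const_add _

theorem strictMono_setIntegral_Iic {w : ℝ → ℝ} (hc : Continuous w) (hi : Integrable w)
    (hp : ∀ x, 0 < w x) : StrictMono (fun y => ∫ t in Set.Iic y, w t) :=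
  strictMono_of_hasDerivAt_pos (fun y => hasDerivAt_setIntegral_Iic hc hi y) hp

theorem setIntegral_Iic_mem_Ioo {w : ℝ → ℝ} (hc : Continuous w) (hi : Integrable w)
    (hp : ∀ x, 0 < w x) (y : ℝ) : (∫ t in Set.Iic y, w t) ∈ Set.Ioo 0 (∫ t, w t) := by
  have hm := strictMono_setIntegral_Iic hc hi hp
  have h1 : 0 ≤ ∫ t in Set.Iic (y - 1), w t :=
    setIntegral_nonneg measurableSet_Iic fun x _ => (hp x).le
  have h2 : (∫ t in Set.Iic (y + 1), w t) ≤ ∫ t, w t :=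
    setIntegral_le_integral hi (Filter.Eventually.of_forall fun x => (hp x).le)
  exact ⟨h1.trans_lt (hm (by linarith)), (hm (by linarith : y < y + 1)).trans_le h2⟩

theorem exists_setIntegral_Iic_eq {w : ℝ → ℝ} (hc : Continuous w) (hi : Integrable w)
    {a : ℝ} (ha : a ∈ Set.Ioo 0 (∫ t, w t)) : ∃ y, (∫ t in Set.Iic y, w t) = a := by
  have hcont : Continuous (fun y => ∫ t in Set.Iic y, w t) :=
    continuous_iff_continuousAt.2 fun y => (hasDerivAt_setIntegral_Iic hc hi y).continuousAt
  have hT : Filter.Tendsto (fun y => ∫ t in Set.Iic y, w t) Filter.atTop (nhds (∫ t, w t)) :=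
    (aecover_Iic Filter.tendsto_id).integral_tendsto_of_countably_generated hi
  have hI : Filter.Tendsto (fun y => ∫ t in Set.Ioi y, w t) Filter.atBot (nhds (∫ t, w t)) :=
    (aecover_Ioi Filter.tendsto_id).integral_tendsto_of_countably_generated hi
  have hB : Filter.Tendsto (fun y => ∫ t in Set.Iic y, w t) Filter.atBot (nhds 0) := by
    have h : (fun y => ∫ t in Set.Iic y, w t) = fun y => (∫ t, w t) - ∫ t in Set.Ioi y, w t := by
      funext y
      rw [← intervalIntegral.integral_Iic_add_Ioi (b := y) hi.integrableOn hi.integrableOn]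
      ring
    rw [h]
    simpa using hI.const_sub (∫ t, w t)
  obtain ⟨y₁, h₁⟩ := (hB.eventually_lt_const ha.1).exists
  obtain ⟨y₂, h₂⟩ := (hT.eventually_const_lt ha.2).exists
  obtain ⟨y, hy⟩ := mem_range_of_exists_le_of_exists_ge hcont ⟨y₁, h₁.le⟩ ⟨y₂, h₂.le⟩
  exact ⟨y, hy⟩

/-- The monotone transport map between two positive continuous densities of equal mass. -/
theorem exists_transport {p w : ℝ → ℝ} (hpc : Continuous p) (hpi : Integrable p)
    (hpp : ∀ x, 0 < p x) (hwc : Continuous w) (hwi : Integrable w) (hwp : ∀ x, 0 < w x)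
    (hpw : ∫ x, p x = ∫ x, w x) :
    ∃ T : ℝ → ℝ, ∀ x, (∫ t in Set.Iic (T x), w t) = (∫ t in Set.Iic x, p t) ∧
      HasDerivAt T (p x / w (T x)) x := by
  set G : ℝ → ℝ := fun y => ∫ t in Set.Iic y, w t
  have hGm : StrictMono G := strictMono_setIntegral_Iic hwc hwi hwp
  have hex : ∀ a ∈ Set.Ioo 0 (∫ t, w t), G (Function.invFun G a) = a := fun a ha =>
    Function.invFun_eq (exists_setIntegral_Iic_eq hwc hwi ha)
  have hmem : ∀ x, (∫ t in Set.Iic x, p t) ∈ Set.Ioo 0 (∫ t, w t) := fun x => by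
    rw [← hpw]; exact setIntegral_Iic_mem_Ioo hpc hpi hpp x
  refine ⟨fun x => Function.invFun G (∫ t in Set.Iic x, p t), fun x => ⟨hex _ (hmem x), ?_⟩⟩
  set a := ∫ t in Set.Iic x, p t with ha
  have hnhds : Set.Ioo 0 (∫ t, w t) ∈ nhds a := isOpen_Ioo.mem_nhds (hmem x)
  have hmono : StrictMonoOn (Function.invFun G) (Set.Ioo 0 (∫ t, w t)) := by
    intro b hb c hc hbc
    rw [← hGm.lt_iff_lt, hex b hb, hex c hc]
    exact hbc
  have himg : Function.invFun G '' Set.Ioo 0 (∫ t, w t) = Set.univ := by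
    refine Set.eq_univ_of_forall fun y => ⟨G y, setIntegral_Iic_mem_Ioo hwc hwi hwp y, ?_⟩
    exact Function.leftInverse_invFun hGm.injective y
  have hcont : ContinuousAt (Function.invFun G) a :=
    hmono.continuousAt_of_image_mem_nhds hnhds (by rw [himg]; exact Filter.univ_mem)
  have hinv : HasDerivAt (Function.invFun G) (w (Function.invFun G a))⁻¹ a :=
    HasDerivAt.of_local_left_inverse hcont (hasDerivAt_setIntegral_Iic hwc hwi _) (hwp _).ne'
      (Filter.mem_of_superset hnhds hex)
  have := hinv.comp x (hasDerivAt_setIntegral_Iic hpc hpi x)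
  rw [div_eq_mul_inv, mul_comm]
  exact this

theorem stdGaussianPDF_eq (x : ℝ) :
    gaussianPDFReal 0 1 x = (√(2 * Real.pi))⁻¹ * Real.exp (-x ^ 2 / 2) := by
  simp [gaussianPDFReal]

theorem continuous_stdGaussianPDF : Continuous (gaussianPDFReal 0 1) := by
  have : gaussianPDFReal 0 1 = fun x => (√(2 * Real.pi))⁻¹ * Real.exp (-x ^ 2 / 2) :=
    funext stdGaussianPDF_eq
  rw [this]
  fun_prop

theorem hasDerivAt_stdGaussianPDF (x : ℝ) :
    HasDerivAt (gaussianPDFReal 0 1) (-x * gaussianPDFReal 0 1 x) x := by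
  have : gaussianPDFReal 0 1 = fun x => (√(2 * Real.pi))⁻¹ * Real.exp (-x ^ 2 / 2) :=
    funext stdGaussianPDF_eq
  rw [this]
  have h := ((((hasDerivAt_id x).pow 2).neg.div_const 2).exp).const_mul (√(2 * Real.pi))⁻¹
  refine h.congr_deriv ?_
  simp
  ring

theorem setIntegral_Ioi_add_stdGaussianPDF_le {x K : ℝ} (hx : 0 ≤ x) (hK : 0 ≤ K) :
    ∫ t in Set.Ioi (x + K), gaussianPDFReal 0 1 t ≤
      Real.exp (-K ^ 2 / 2) * ∫ t in Set.Ioi x, gaussianPDFReal 0 1 t := by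
  have hi := integrable_gaussianPDFReal 0 1
  have h := (measurePreserving_add_right volume K).setIntegral_preimage_emb
    (MeasurableEquiv.addRight K).measurableEmbedding (gaussianPDFReal 0 1) (Set.Ioi (x + K))
  have hpre : (fun t => t + K) ⁻¹' Set.Ioi (x + K) = Set.Ioi x := by
    ext t; simp
  rw [hpre] at h
  rw [← h, ← integral_const_mul]
  refine setIntegral_mono_on (hi.comp_add_right K).integrableOn (hi.const_mul _).integrableOn
    measurableSet_Ioi fun t ht => ?_
  have ht : x < t := ht
  rw [stdGaussianPDF_eq, stdGaussianPDF_eq, mul_left_comm, ← Real.exp_add]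
  gcongr
  nlinarith [mul_nonneg (hx.trans ht.le) hK]

theorem transport_le_add {w : ℝ → ℝ} (hwi : Integrable w) {D K x y : ℝ}
    (hw : ∀ t, w t ≤ Real.exp D * gaussianPDFReal 0 1 t) (hK : 0 ≤ K) (hKD : D < K ^ 2 / 2)
    (hwp : ∀ t, 0 < w t) (hx : 0 ≤ x)
    (h : ∫ t in Set.Ioi y, w t = ∫ t in Set.Ioi x, gaussianPDFReal 0 1 t) : y ≤ x + K := by
  by_contra! hlt
  have hi := integrable_gaussianPDFReal 0 1
  have hpos : 0 < ∫ t in Set.Ioi x, gaussianPDFReal 0 1 t := by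
    rw [setIntegral_pos_iff_support_of_nonneg_ae
      (Filter.Eventually.of_forall fun t => gaussianPDFReal_nonneg 0 1 t) hi.integrableOn]
    have : Function.support (gaussianPDFReal 0 1) = Set.univ :=
      Set.eq_univ_of_forall fun t => (gaussianPDFReal_pos 0 1 t one_ne_zero).ne'
    simp [this]
  have h1 : ∫ t in Set.Ioi y, w t ≤ ∫ t in Set.Ioi (x + K), w t :=
    setIntegral_mono_set hwi.integrableOn (Filter.Eventually.of_forall fun t => (hwp t).le)
      (Set.Ioi_subset_Ioi hlt.le).eventuallyLE
  have h2 : ∫ t in Set.Ioi (x + K), w t ≤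
      Real.exp D * ∫ t in Set.Ioi (x + K), gaussianPDFReal 0 1 t := by
    rw [← integral_const_mul]
    exact setIntegral_mono hwi.integrableOn (hi.const_mul _).integrableOn hw
  have h3 := mul_le_mul_of_nonneg_left (setIntegral_Ioi_add_stdGaussianPDF_le hx hK)
    (Real.exp_pos D).le
  rw [← mul_assoc, ← Real.exp_add] at h3
  have h4 : Real.exp (D + -K ^ 2 / 2) < 1 := Real.exp_lt_one_iff.2 (by linarith)
  have h5 := mul_lt_mul_of_pos_right h4 hpos
  linarith

theorem sub_le_transport {w : ℝ → ℝ} (hwi : Integrable w) {D K x y : ℝ}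
    (hw : ∀ t, w t ≤ Real.exp D * gaussianPDFReal 0 1 t) (hK : 0 ≤ K) (hKD : D < K ^ 2 / 2)
    (hwp : ∀ t, 0 < w t) (hx : x ≤ 0)
    (h : ∫ t in Set.Iic y, w t = ∫ t in Set.Iic x, gaussianPDFReal 0 1 t) : x - K ≤ y := by
  have heven : ∀ t, gaussianPDFReal 0 1 (-t) = gaussianPDFReal 0 1 t := fun t => by
    simp [stdGaussianPDF_eq]
  have := transport_le_add (w := fun t => w (-t)) (D := D) (K := K) (x := -x) (y := -y)
    hwi.comp_neg (fun t => (hw _).trans_eq (by rw [heven])) hK hKD (fun t => hwp _)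
    (by linarith) (by
      rw [integral_comp_neg_Ioi, neg_neg, h]
      rw [← integral_comp_neg_Iic]
      exact integral_congr_ae (Filter.Eventually.of_forall fun t => (heven t).symm))
  linarith

theorem integral_sq_stdGaussian : ∫ x, x ^ 2 ∂(gaussianReal 0 1) = 1 := by
  have h := variance_fun_id_gaussianReal (μ := 0) (v := 1)
  rw [variance_eq_integral aemeasurable_id'] at h
  simpa using h

theorem integrable_sq_stdGaussian : Integrable (fun x : ℝ => x ^ 2) (gaussianReal 0 1) :=
  (memLp_id_gaussianReal (μ := 0) (v := 1) 2).integrable_sq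

theorem integrable_gaussianReal_iff {g : ℝ → ℝ} :
    Integrable g (gaussianReal 0 1) ↔ Integrable fun x => g x * gaussianPDFReal 0 1 x := by
  rw [gaussianReal_of_var_ne_zero _ one_ne_zero,
    integrable_withDensity_iff (measurable_gaussianPDF 0 1)
      (Filter.Eventually.of_forall fun _ => ENNReal.ofReal_lt_top)]
  simp_rw [toReal_gaussianPDF]

theorem integral_stdGaussian_eq (g : ℝ → ℝ) :
    ∫ x, g x ∂(gaussianReal 0 1) = ∫ x, g x * gaussianPDFReal 0 1 x := by
  rw [integral_gaussianReal_eq_integral_smul one_ne_zero]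
  simp_rw [smul_eq_mul, mul_comm]

theorem integrable_of_bounded {α : Type*} [MeasurableSpace α] {μ : Measure α} [IsFiniteMeasure μ]
    {f : α → ℝ} (hf : AEStronglyMeasurable f μ) {C : ℝ} (hC : ∀ x, |f x| ≤ C) : Integrable f μ :=
  Integrable.of_bound hf C (Filter.Eventually.of_forall hC)

open Filter Topology in
/-- Dual form of Talagrand's transport inequality for the standard Gaussian measure on `ℝ`. -/
theorem integral_exp_le_of_infConv {h f : ℝ → ℝ} (hh : Continuous h) (hf : Continuous f)
    {C : ℝ} (hC : ∀ x, |h x| ≤ C) (hC' : ∀ x, |f x| ≤ C)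
    (hhf : ∀ x y, h x ≤ f y + (x - y) ^ 2 / 2) :
    ∫ x, Real.exp (h x) ∂(gaussianReal 0 1) ≤ Real.exp (∫ x, f x ∂(gaussianReal 0 1)) := by
  set p := gaussianPDFReal 0 1 with hp
  have hpi : Integrable p := integrable_gaussianPDFReal 0 1
  have hpc : Continuous p := continuous_stdGaussianPDF
  have hpp : ∀ x, 0 < p x := fun x => gaussianPDFReal_pos 0 1 x one_ne_zero
  have hint : Integrable (fun x => Real.exp (h x)) (gaussianReal 0 1) :=
    integrable_of_bounded (by fun_prop) (C := Real.exp C) fun x => by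
      rw [abs_of_pos (Real.exp_pos _)]
      exact Real.exp_le_exp.2 ((le_abs_self _).trans (hC x))
  set Z := ∫ x, Real.exp (h x) ∂(gaussianReal 0 1) with hZ
  have hZpos : 0 < Z := integral_exp_pos hint
  set ℓ := Real.log Z with hℓ
  set w : ℝ → ℝ := fun x => Real.exp (h x - ℓ) * p x with hw
  have hwZ : ∀ x, w x = Z⁻¹ * (Real.exp (h x) * p x) := fun x => by
    simp only [hw, hℓ, Real.exp_sub, Real.exp_log hZpos]
    field_simp
  have hwc : Continuous w := by fun_prop
  have hwp : ∀ x, 0 < w x := fun x => mul_pos (Real.exp_pos _) (hpp x)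
  have hwi : Integrable w := by
    rw [show w = _ from funext hwZ]
    exact (integrable_gaussianReal_iff.1 hint).const_mul _
  have hpw : ∫ x, p x = ∫ x, w x := by
    rw [show w = _ from funext hwZ, integral_const_mul, ← integral_stdGaussian_eq, ← hZ,
      inv_mul_cancel₀ hZpos.ne']
    exact integral_gaussianPDFReal_eq_one 0 one_ne_zero
  obtain ⟨T, hT⟩ := exists_transport hpc hpi hpp hwc hwi hwp hpw
  have hwD : ∀ t, w t ≤ Real.exp (C - ℓ) * p t := fun t => by
    have := (le_abs_self _).trans (hC t)
    simp only [hw]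
    gcongr
    exact (hpp t).le
  obtain ⟨K, hK, hKD⟩ : ∃ K : ℝ, 0 ≤ K ∧ C - ℓ < K ^ 2 / 2 := by
    refine ⟨√(2 * (|C - ℓ| + 1)), Real.sqrt_nonneg _, ?_⟩
    rw [Real.sq_sqrt (by positivity)]
    linarith [le_abs_self (C - ℓ)]
  have hup : ∀ x, 0 ≤ x → T x ≤ x + K := fun x hx => by
    refine transport_le_add hwi hwD hK hKD hwp hx ?_
    have h1 := intervalIntegral.integral_Iic_add_Ioi (b := T x) hwi.integrableOn hwi.integrableOn
    have h2 := intervalIntegral.integral_Iic_add_Ioi (b := x) hpi.integrableOn hpi.integrableOn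
    have h3 := (hT x).1
    rw [← hp]
    linarith
  have hlow : ∀ x, x ≤ 0 → x - K ≤ T x := fun x hx =>
    sub_le_transport hwi hwD hK hKD hwp hx (hT x).1
  set g : ℝ → ℝ := fun x => f x + (x ^ 2 - (1 + ℓ)) with hg
  have hfi : Integrable f (gaussianReal 0 1) := integrable_of_bounded hf.aestronglyMeasurable hC'
  have hqi : Integrable (fun x : ℝ => x ^ 2 - (1 + ℓ)) (gaussianReal 0 1) :=
    integrable_sq_stdGaussian.sub (integrable_const _)
  have hgi : Integrable g (gaussianReal 0 1) := hfi.add hqi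
  have hgint : ∫ x, g x ∂(gaussianReal 0 1) = (∫ x, f x ∂(gaussianReal 0 1)) - ℓ := by
    have hq : ∫ x, (x ^ 2 - (1 + ℓ)) ∂(gaussianReal 0 1) = -ℓ := by
      rw [integral_sub integrable_sq_stdGaussian (integrable_const _), integral_sq_stdGaussian]
      simp
    rw [hg, integral_add hfi hqi, hq, sub_eq_add_neg]
  have hgp : Integrable fun x => g x * p x := integrable_gaussianReal_iff.1 hgi
  have hderiv : ∀ x, HasDerivAt (fun x => -(T x * p x))
      (-(p x / w (T x) * p x + T x * (-x * p x))) x := fun x =>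
    ((hT x).2.mul (hasDerivAt_stdGaussianPDF x)).neg
  have hbound : ∀ x, -(p x / w (T x) * p x + T x * (-x * p x)) ≤ g x * p x := fun x => by
    have hquot : p x / w (T x) = Real.exp (ℓ - h (T x) - x ^ 2 / 2 + T x ^ 2 / 2) := by
      rw [div_eq_iff (hwp _).ne']
      simp only [hw, hp, stdGaussianPDF_eq]
      rw [mul_left_comm (Real.exp (h _ - _)), mul_left_comm (Real.exp _), ← Real.exp_add,
        ← Real.exp_add]
      congr 2
      ring
    have h1 := Real.add_one_le_exp (ℓ - h (T x) - x ^ 2 / 2 + T x ^ 2 / 2)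
    rw [← hquot] at h1
    have h2 := hhf (T x) x
    have h3 : -(p x / w (T x)) + T x * x ≤ g x := by
      simp only [hg]
      nlinarith
    nlinarith [mul_le_mul_of_nonneg_right h3 (hpp x).le]
  have hmain : ∀ N : ℝ, 0 ≤ N → -(2 * (N + K) * p N) ≤ ∫ x in (-N)..N, g x * p x := fun N hN => by
    have h1 := intervalIntegral.sub_le_integral_of_hasDeriv_right_of_le (a := -N) (b := N)
      (by linarith) (fun x _ => (hderiv x).continuousAt.continuousWithinAt)
      (fun x _ => (hderiv x).hasDerivWithinAt) hgp.integrableOn (fun x _ => hbound x)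
    have h2 : p (-N) = p N := by simp [hp, stdGaussianPDF_eq]
    rw [h2] at h1
    have h3 := mul_le_mul_of_nonneg_right (hup N hN) (hpp N).le
    have h4 := mul_le_mul_of_nonneg_right (hlow (-N) (by linarith)) (hpp N).le
    linarith
  have hlim1 : Tendsto (fun N : ℝ => ∫ x in (-N)..N, g x * p x) atTop
      (𝓝 ((∫ x, f x ∂(gaussianReal 0 1)) - ℓ)) := by
    rw [← hgint, integral_stdGaussian_eq]
    exact intervalIntegral_tendsto_integral hgp tendsto_neg_atTop_atBot tendsto_id
  have hlim2 : Tendsto (fun N : ℝ => -(2 * (N + K) * p N)) atTop (𝓝 0) := by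
    have he : Tendsto (fun N : ℝ => N ^ 1 * Real.exp (-N)) atTop (𝓝 0) :=
      Real.tendsto_pow_mul_exp_neg_atTop_nhds_zero 1
    have he0 : Tendsto (fun N : ℝ => Real.exp (-N)) atTop (𝓝 0) :=
      Real.tendsto_exp_neg_atTop_nhds_zero
    have hB : Tendsto (fun N : ℝ => 2 * (√(2 * Real.pi))⁻¹ *
        (N ^ 1 * Real.exp (-N) + K * Real.exp (-N))) atTop (𝓝 0) := by
      simpa using (he.add (he0.const_mul K)).const_mul (2 * (√(2 * Real.pi))⁻¹)
    have hpos : Tendsto (fun N : ℝ => 2 * (N + K) * p N) atTop (𝓝 0) := by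
      refine squeeze_zero' ?_ ?_ hB
      · filter_upwards [eventually_ge_atTop 0] with N hN
        have := (hpp N).le
        positivity
      · filter_upwards [eventually_ge_atTop 2] with N hN
        have h1 : Real.exp (-N ^ 2 / 2) ≤ Real.exp (-N) := Real.exp_le_exp.2 (by nlinarith)
        have h2 : p N ≤ (√(2 * Real.pi))⁻¹ * Real.exp (-N) := by
          rw [hp, stdGaussianPDF_eq]
          gcongr
        have h3 := mul_le_mul_of_nonneg_left h2 (by linarith : 0 ≤ 2 * (N + K))
        linarith
    simpa using hpos.neg
  have hfin : 0 ≤ (∫ x, f x ∂(gaussianReal 0 1)) - ℓ :=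
    le_of_tendsto_of_tendsto hlim2 hlim1 (by
      filter_upwards [eventually_ge_atTop 0] with N hN using hmain N hN)
  rw [← Real.exp_log hZpos]
  exact Real.exp_le_exp.2 (by linarith)

theorem integral_pi_succ {n : ℕ} (μ : Measure ℝ) [IsProbabilityMeasure μ]
    {F : (Fin (n + 1) → ℝ) → ℝ}
    (hF : Continuous F) {C : ℝ} (hC : ∀ x, |F x| ≤ C) :
    ∫ z, F z ∂(Measure.pi fun _ : Fin (n + 1) => μ) =
      ∫ a, ∫ y, F (Fin.cons a y) ∂(Measure.pi fun _ : Fin n => μ) ∂μ := by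
  have hmp := (measurePreserving_piFinSuccAbove (fun _ : Fin (n + 1) => μ) 0).symm
  rw [← hmp.integral_comp' F, integral_prod]
  · simp [MeasurableEquiv.piFinSuccAbove, Fin.insertNthEquiv]
  · refine integrable_of_bounded ?_ (fun x => hC _)
    exact (hF.measurable.comp (MeasurableEquiv.measurable _)).aestronglyMeasurable

theorem continuous_integral_cons {n : ℕ} (μ : Measure (Fin n → ℝ)) [IsProbabilityMeasure μ]
    {F : (Fin (n + 1) → ℝ) → ℝ} (hF : Continuous F) {C : ℝ} (hC : ∀ x, |F x| ≤ C) :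
    Continuous fun a : ℝ => ∫ y, F (Fin.cons a y) ∂μ := by
  refine continuous_of_dominated (bound := fun _ => C) (fun a => ?_) (fun a => ?_)
    (integrable_const _) ?_
  · exact Continuous.aestronglyMeasurable (by fun_prop)
  · exact Filter.Eventually.of_forall fun y => hC _
  · exact Filter.Eventually.of_forall fun y => by fun_prop

/-- Dual form of Talagrand's transport inequality for the standard Gaussian measure on `ℝⁿ`. -/
theorem pi_integral_exp_le_of_infConv {n : ℕ} {h f : (Fin n → ℝ) → ℝ} (hh : Continuous h)
    (hf : Continuous f) {C : ℝ} (hC : ∀ x, |h x| ≤ C) (hC' : ∀ x, |f x| ≤ C)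
    (hhf : ∀ x y, h x ≤ f y + (∑ i, (x i - y i) ^ 2) / 2) :
    ∫ x, Real.exp (h x) ∂(Measure.pi fun _ : Fin n => gaussianReal 0 1) ≤
      Real.exp (∫ x, f x ∂(Measure.pi fun _ : Fin n => gaussianReal 0 1)) := by
  induction n generalizing C with
  | zero =>
    have h1 : ∀ x, h x = h 0 := fun x => congrArg h (Subsingleton.elim _ _)
    have h2 : ∀ x, f x = f 0 := fun x => congrArg f (Subsingleton.elim _ _)
    simp_rw [h1, h2]
    simpa using hhf 0 0
  | succ n ih =>
    set γ := Measure.pi fun _ : Fin n => gaussianReal 0 1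
    have hexpC : ∀ x, |Real.exp (h x)| ≤ Real.exp C := fun x => by
      rw [abs_of_pos (Real.exp_pos _)]
      exact Real.exp_le_exp.2 ((le_abs_self _).trans (hC x))
    have hexpi : ∀ a : ℝ, Integrable (fun y => Real.exp (h (Fin.cons a y))) γ := fun a =>
      integrable_of_bounded (Continuous.aestronglyMeasurable (by fun_prop)) (fun y => hexpC _)
    rw [integral_pi_succ _ hf hC', integral_pi_succ _ (by fun_prop) hexpC]
    set H : ℝ → ℝ := fun a => ∫ y, Real.exp (h (Fin.cons a y)) ∂γ
    have hHpos : ∀ a, 0 < H a := fun a => integral_exp_pos (hexpi a)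
    have hHc : Continuous H := continuous_integral_cons γ (by fun_prop) hexpC
    have hHC : ∀ a, |Real.log (H a)| ≤ C := fun a => by
      rw [abs_le]
      constructor
      · rw [Real.le_log_iff_exp_le (hHpos a)]
        calc Real.exp (-C) = ∫ _, Real.exp (-C) ∂γ := by simp
          _ ≤ H a := integral_mono (integrable_const _) (hexpi a) fun y =>
            Real.exp_le_exp.2 (abs_le.1 (hC _)).1
      · rw [Real.log_le_iff_le_exp (hHpos a)]
        calc H a ≤ ∫ _, Real.exp C ∂γ := integral_mono (hexpi a) (integrable_const _) fun y =>
              Real.exp_le_exp.2 (abs_le.1 (hC _)).2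
          _ = Real.exp C := by simp
    have hgC : ∀ a, |∫ y, f (Fin.cons a y) ∂γ| ≤ C := fun a => by
      have := norm_integral_le_of_norm_le_const (μ := γ) (f := fun y => f (Fin.cons a y))
        (Filter.Eventually.of_forall fun y => hC' (Fin.cons a y))
      simpa using this
    have hstep : ∀ a b : ℝ, Real.log (H a) ≤ (∫ y, f (Fin.cons b y) ∂γ) + (a - b) ^ 2 / 2 := by
      intro a b
      rw [Real.log_le_iff_le_exp (hHpos a)]
      have h1 := ih (h := fun y => h (Fin.cons a y) - (a - b) ^ 2 / 2)
        (f := fun y => f (Fin.cons b y)) (by fun_prop) (by fun_prop) (C := C + (a - b) ^ 2 / 2)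
        (fun y => by
          have h2 := abs_le.1 (hC (Fin.cons a y))
          have h3 : 0 ≤ (a - b) ^ 2 / 2 := by positivity
          exact abs_le.2 ⟨by linarith, by linarith⟩)
        (fun y => (hC' _).trans (by linarith [sq_nonneg (a - b)]))
        (fun x y => by
          have h2 := hhf (Fin.cons a x) (Fin.cons b y)
          rw [Fin.sum_univ_succ] at h2
          simp only [Fin.cons_zero, Fin.cons_succ] at h2
          linarith)
      simp_rw [Real.exp_sub] at h1
      rw [integral_div, div_le_iff₀ (Real.exp_pos _), ← Real.exp_add] at h1
      exact h1
    have hfin := integral_exp_le_of_infConv (h := fun a => Real.log (H a))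
      (f := fun a => ∫ y, f (Fin.cons a y) ∂γ) (hHc.log fun a => (hHpos a).ne')
      (continuous_integral_cons γ hf hC') hHC hgC hstep
    simp_rw [Real.exp_log (hHpos _)] at hfin
    exact hfin

/-- Gaussian concentration: the Laplace transform of a bounded Lipschitz function. -/
theorem integral_exp_mul_lipschitz_le {n : ℕ} {Y : (Fin n → ℝ) → ℝ} (hY : Continuous Y) {C : ℝ}
    (hC : ∀ x, |Y x| ≤ C) (hL : ∀ x y, Y x - Y y ≤ √(∑ i, (x i - y i) ^ 2)) {θ : ℝ} (hθ : 0 ≤ θ) :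
    ∫ x, Real.exp (θ * Y x) ∂(Measure.pi fun _ : Fin n => gaussianReal 0 1) ≤
      Real.exp (θ ^ 2 / 2 + θ * ∫ x, Y x ∂(Measure.pi fun _ : Fin n => gaussianReal 0 1)) := by
  have hθC : ∀ x, |θ * Y x| ≤ θ * C := fun x => by
    rw [abs_mul, abs_of_nonneg hθ]
    exact mul_le_mul_of_nonneg_left (hC x) hθ
  have h1 := pi_integral_exp_le_of_infConv (h := fun x => θ * Y x - θ ^ 2 / 2)
    (f := fun x => θ * Y x) (C := θ * C + θ ^ 2 / 2) (by fun_prop) (by fun_prop)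
    (fun x => by
      have h2 := abs_le.1 (hθC x)
      have h3 : 0 ≤ θ ^ 2 / 2 := by positivity
      exact abs_le.2 ⟨by linarith, by linarith⟩)
    (fun x => (hθC x).trans (by linarith [sq_nonneg θ]))
    (fun x y => by
      have h2 := mul_le_mul_of_nonneg_left (hL x y) hθ
      have h3 : √(∑ i, (x i - y i) ^ 2) ^ 2 = ∑ i, (x i - y i) ^ 2 :=
        Real.sq_sqrt (Finset.sum_nonneg fun i _ => sq_nonneg _)
      nlinarith [sq_nonneg (θ - √(∑ i, (x i - y i) ^ 2))])
  simp_rw [Real.exp_sub] at h1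
  rw [integral_div, div_le_iff₀ (Real.exp_pos _), ← Real.exp_add, integral_const_mul] at h1
  rwa [add_comm]

theorem stdPhi_eq_integral (t : ℝ) : stdPhi t = ∫ x in Set.Iic t, gaussianPDFReal 0 1 x := by
  rw [stdPhi, gaussianReal_apply_eq_integral 0 one_ne_zero, ENNReal.toReal_ofReal]
  exact setIntegral_nonneg measurableSet_Iic fun x _ => gaussianPDFReal_nonneg 0 1 x

theorem one_sub_stdPhi_eq_integral (t : ℝ) :
    1 - stdPhi t = ∫ x in Set.Ioi t, gaussianPDFReal 0 1 x := by
  have hi := integrable_gaussianPDFReal 0 1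
  have h := intervalIntegral.integral_Iic_add_Ioi (b := t) hi.integrableOn hi.integrableOn
  rw [integral_gaussianPDFReal_eq_one 0 one_ne_zero] at h
  rw [stdPhi_eq_integral]
  linarith

theorem stdPhi_mono : Monotone stdPhi := fun _ _ h =>
  ENNReal.toReal_mono (measure_ne_top _ _) (measure_mono (Set.Iic_subset_Iic.2 h))

theorem half_exp_le_one_sub_stdPhi {t : ℝ} (ht : 0 ≤ t) :
    1 / 2 * Real.exp (-t ^ 2 / 2 - 6 / 5 * t) ≤ 1 - stdPhi t := by
  have hi := integrable_gaussianPDFReal 0 1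
  set p := gaussianPDFReal 0 1 with hp
  have hpp : ∀ x, 0 < p x := fun x => gaussianPDFReal_pos 0 1 x one_ne_zero
  rw [one_sub_stdPhi_eq_integral]
  have h := (measurePreserving_add_right volume t).setIntegral_preimage_emb
    (MeasurableEquiv.addRight t).measurableEmbedding p (Set.Ioi t)
  have hpre : (fun s => s + t) ⁻¹' Set.Ioi t = Set.Ioi 0 := by
    ext s; simp
  rw [hpre] at h
  rw [← h]
  have hs2 : Integrable fun s : ℝ => s ^ 2 * p s :=
    integrable_gaussianReal_iff.1 integrable_sq_stdGaussian
  have hg : Integrable fun s : ℝ => (1 + 7 / 10 * t) * p s - t / 2 * (s ^ 2 * p s) :=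
    (hi.const_mul _).sub (hs2.const_mul _)
  have hhalf : 1 / 2 ≤ ∫ s in Set.Ioi 0, ((1 + 7 / 10 * t) * p s - t / 2 * (s ^ 2 * p s)) := by
    have h1 := integral_comp_abs (f := fun s => (1 + 7 / 10 * t) * p s - t / 2 * (s ^ 2 * p s))
    have h2 : (fun s : ℝ => (1 + 7 / 10 * t) * p |s| - t / 2 * (|s| ^ 2 * p |s|)) =
        fun s => (1 + 7 / 10 * t) * p s - t / 2 * (s ^ 2 * p s) := by
      funext s
      simp [hp, stdGaussianPDF_eq]
    rw [h2, integral_sub (hi.const_mul _) (hs2.const_mul _), integral_const_mul,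
      integral_const_mul, ← integral_stdGaussian_eq, integral_sq_stdGaussian,
      integral_gaussianPDFReal_eq_one 0 one_ne_zero] at h1
    linarith
  calc 1 / 2 * Real.exp (-t ^ 2 / 2 - 6 / 5 * t)
      ≤ Real.exp (-t ^ 2 / 2 - 6 / 5 * t) *
        ∫ s in Set.Ioi 0, ((1 + 7 / 10 * t) * p s - t / 2 * (s ^ 2 * p s)) := by
        rw [mul_comm]
        gcongr
    _ ≤ ∫ s in Set.Ioi 0, p (s + t) := by
        rw [← integral_const_mul]
        refine setIntegral_mono (hg.const_mul _).integrableOn (hi.comp_add_right t).integrableOn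
          fun s => ?_
        have h1 : p (s + t) = Real.exp (-t ^ 2 / 2 - 6 / 5 * t) *
            (Real.exp (6 / 5 * t - s * t) * p s) := by
          simp only [hp, stdGaussianPDF_eq]
          rw [mul_left_comm (Real.exp (6 / 5 * t - s * t)), mul_left_comm (Real.exp _),
            ← Real.exp_add, ← Real.exp_add]
          congr 2
          ring
        rw [h1]
        gcongr
        have h2 := Real.add_one_le_exp (6 / 5 * t - s * t)
        have h3 := mul_le_mul_of_nonneg_right h2 (hpp s).le
        have h4 : 0 ≤ t * (s - 1) ^ 2 * p s := mul_nonneg (by positivity) (hpp s).le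
        linarith

theorem log_two_sqrt_bound : (0.8325 : ℝ) ≤ √(Real.log 2) :=
  Real.le_sqrt_of_sq_le (by have := Real.log_two_gt_d9; norm_num at this ⊢; linarith)

theorem exp_neg_sq_le_one_sub_stdPhi {t : ℝ} (ht : 0 ≤ t) :
    Real.exp (-(t + 6 / 5) ^ 2 / 2) ≤ 1 - stdPhi t := by
  refine le_trans ?_ (half_exp_le_one_sub_stdPhi ht)
  have h1 : -(t + 6 / 5) ^ 2 / 2 = -(18 / 25) + (-t ^ 2 / 2 - 6 / 5 * t) := by ring
  rw [h1, Real.exp_add]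
  gcongr
  rw [show (1 / 2 : ℝ) = Real.exp (-Real.log 2) by rw [Real.exp_neg, Real.exp_log] <;> norm_num]
  have := Real.log_two_lt_d9
  exact Real.exp_le_exp.2 (by norm_num at this ⊢; linarith)

/-- The mean of a Lipschitz function that is small wherever an integrable variable `U` is small. -/
theorem integral_lipschitz_le_of_noise {n : ℕ} {Y U : (Fin n → ℝ) → ℝ} (hY : Continuous Y) {C : ℝ}
    (hC : ∀ x, |Y x| ≤ C) (hL : ∀ x y, Y x - Y y ≤ √(∑ i, (x i - y i) ^ 2))
    (hU : Integrable U (Measure.pi fun _ : Fin n => gaussianReal 0 1)) (hUhalf : ∀ x, 1 / 2 ≤ U x)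
    (hU1 : ∫ x, U x ∂(Measure.pi fun _ : Fin n => gaussianReal 0 1) ≤ 1)
    (hgood : ∀ x, U x ≤ 32 → Y x ≤ -(√(Real.log 2) *
      (4 - √(8 / 3 * max 1 (1 + Real.log (U x) / Real.log 2))))) :
    ∫ x, Y x ∂(Measure.pi fun _ : Fin n => gaussianReal 0 1) ≤ -(6 / 5) := by
  set γ := Measure.pi fun _ : Fin n => gaussianReal 0 1
  set m := ∫ x, Y x ∂γ with hm
  set c := √(Real.log 2)
  have hc0 : 0.8325 ≤ c := log_two_sqrt_bound
  have hlog2 : 0 < Real.log 2 := Real.log_pos one_lt_two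
  set V : (Fin n → ℝ) → ℝ := fun x =>
    c * (-4 + 2.31 / 2 + 8 / 3 * (2 + (U x - 1) / Real.log 2) / (2 * 2.31)) +
      (max m 0 + 2) / 32 * U x + Real.exp (-2 * m - 5) / 2 * Real.exp (2 * Y x) with hV
  have hYV : ∀ x, Y x ≤ V x := by
    intro x
    have hUx := hUhalf x
    have hUpos : 0 < U x := by linarith
    set K := max 1 (1 + Real.log (U x) / Real.log 2)
    have hKle : K ≤ 2 + (U x - 1) / Real.log 2 := by
      have h1 : Real.log (U x) / Real.log 2 ≤ (U x - 1) / Real.log 2 :=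
        div_le_div_of_nonneg_right (Real.log_le_sub_one_of_pos hUpos) hlog2.le
      have h2 : -1 ≤ Real.log (U x) / Real.log 2 := by
        rw [le_div_iff₀ hlog2, neg_one_mul, ← Real.log_inv]
        exact Real.log_le_log (by norm_num) (by linarith)
      exact max_le (by linarith) (by linarith)
    have hsq : √(8 / 3 * K) ^ 2 = 8 / 3 * K := Real.sq_sqrt (by positivity)
    have hsqrt : √(8 / 3 * K) ≤ 2.31 / 2 + 8 / 3 * (2 + (U x - 1) / Real.log 2) / (2 * 2.31) := by
      have h1 : √(8 / 3 * K) ≤ 2.31 / 2 + 8 / 3 * K / (2 * 2.31) := by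
        have h3 := sq_nonneg (√(8 / 3 * K) - 2.31)
        rw [sub_sq, hsq] at h3
        norm_num at h3 ⊢
        linarith
      have h2 : 8 / 3 * K / (2 * 2.31) ≤ 8 / 3 * (2 + (U x - 1) / Real.log 2) / (2 * 2.31) := by
        gcongr
      linarith
    have hsqrt' := mul_le_mul_of_nonneg_left hsqrt (by linarith : 0 ≤ c)
    have hexp : Real.exp (-2 * m - 5) / 2 * Real.exp (2 * Y x) =
        Real.exp (2 * (Y x - m) - 5) / 2 := by
      rw [div_mul_eq_mul_div, ← Real.exp_add]
      congr 2
      ring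
    have hexp0 := Real.exp_pos (2 * (Y x - m) - 5)
    have hmax : 0 ≤ max m 0 := le_max_right _ _
    simp only [hV]
    rw [hexp]
    by_cases hx : U x ≤ 32
    · have h1 := hgood x hx
      have h2 : 0 ≤ (max m 0 + 2) / 32 * U x := by positivity
      linarith
    · push Not at hx
      have h6 : 6 ≤ K := by
        refine le_trans ?_ (le_max_right _ _)
        have : 5 ≤ Real.log (U x) / Real.log 2 := by
          rw [le_div_iff₀ hlog2, show (5 : ℝ) * Real.log 2 = Real.log (2 ^ 5) by
            rw [Real.log_pow]; norm_num]
          exact Real.log_le_log (by norm_num) (by linarith)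
        linarith
      have h4 : 4 ≤ √(8 / 3 * K) := Real.le_sqrt_of_sq_le (by linarith)
      have h5 := mul_le_mul_of_nonneg_left h4 (by linarith : 0 ≤ c)
      have h7 := Real.add_one_le_exp (2 * (Y x - m) - 5)
      have h8 : max m 0 + 2 ≤ (max m 0 + 2) / 32 * U x := by
        have := mul_le_mul_of_nonneg_left hx.le (by positivity : 0 ≤ (max m 0 + 2) / 32)
        linarith
      have h9 := le_max_left m 0
      linarith
  have hexpi : Integrable (fun x => Real.exp (2 * Y x)) γ :=
    integrable_of_bounded (C := Real.exp (2 * C)) (by fun_prop) fun x => by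
      rw [abs_of_pos (Real.exp_pos _)]
      exact Real.exp_le_exp.2 (by linarith [(abs_le.1 (hC x)).2])
  set a := c * (8 / 3 / Real.log 2 / (2 * 2.31)) with ha
  set b := c * (-4 + 2.31 / 2 + 8 / 3 * (2 - 1 / Real.log 2) / (2 * 2.31)) with hb
  have hVeq : V = fun x => (b + (a + (max m 0 + 2) / 32) * U x) +
      Real.exp (-2 * m - 5) / 2 * Real.exp (2 * Y x) := by
    funext x
    simp only [hV, ha, hb]
    ring
  have hlin : Integrable (fun x => b + (a + (max m 0 + 2) / 32) * U x) γ :=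
    (integrable_const _).add (hU.const_mul _)
  have hVi : Integrable V γ := by
    rw [hVeq]
    exact hlin.add (hexpi.const_mul _)
  have hVint : ∫ x, V x ∂γ = b + (a + (max m 0 + 2) / 32) * ∫ x, U x ∂γ +
      Real.exp (-2 * m - 5) / 2 * ∫ x, Real.exp (2 * Y x) ∂γ := by
    rw [hVeq, integral_add hlin (hexpi.const_mul _),
      integral_add (integrable_const _) (hU.const_mul _), integral_const, probReal_univ, one_smul,
      integral_const_mul, integral_const_mul]
  have h1 : m ≤ ∫ x, V x ∂γ :=
    integral_mono (integrable_of_bounded hY.aestronglyMeasurable hC) hVi hYV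
  have h2 := integral_exp_mul_lipschitz_le hY hC hL (θ := 2) (by norm_num)
  have h3 := mul_le_mul_of_nonneg_left h2 (by positivity : 0 ≤ Real.exp (-2 * m - 5) / 2)
  rw [div_mul_eq_mul_div _ _ (Real.exp (2 ^ 2 / 2 + _)), ← Real.exp_add,
    show -2 * m - 5 + (2 ^ 2 / 2 + 2 * ∫ x, Y x ∂γ) = -3 by rw [← hm]; ring] at h3
  have h4 : Real.exp (-3) ≤ 1 / 4 := by
    rw [Real.exp_neg, one_div]
    exact inv_anti₀ (by norm_num) (by linarith [Real.add_one_le_exp (3 : ℝ)])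
  have hmax : 0 ≤ max m 0 := le_max_right _ _
  have h5 := mul_le_mul_of_nonneg_left hU1 (by positivity : 0 ≤ a + (max m 0 + 2) / 32)
  have h6 : a + b = c * (-4 + 2.31 / 2 + 16 / 3 / (2 * 2.31)) := by
    simp only [ha, hb]
    field_simp
    ring
  have h7 : c * (-4 + 2.31 / 2 + 16 / 3 / (2 * 2.31)) ≤ -1.4073 := by
    norm_num at hc0 ⊢
    linarith
  rcases le_total m 0 with hm0 | hm0
  · rw [max_eq_right hm0] at *
    norm_num at *
    linarith
  · rw [max_eq_left hm0] at *
    norm_num at *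
    linarith

theorem measure_lt_le_of_integral_le {n : ℕ} {Y : (Fin n → ℝ) → ℝ} (hY : Continuous Y) {C : ℝ}
    (hC : ∀ x, |Y x| ≤ C) (hL : ∀ x y, Y x - Y y ≤ √(∑ i, (x i - y i) ^ 2))
    (hm : ∫ x, Y x ∂(Measure.pi fun _ : Fin n => gaussianReal 0 1) ≤ -(6 / 5)) {t : ℝ}
    (ht : 0 ≤ t) :
    (Measure.pi fun _ : Fin n => gaussianReal 0 1) {x | t < Y x} ≤
      ENNReal.ofReal (1 - stdPhi t) := by
  set γ := Measure.pi fun _ : Fin n => gaussianReal 0 1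
  set m := ∫ x, Y x ∂γ with hm'
  have hθ : 0 ≤ t - m := by linarith
  have hexpi : Integrable (fun x => Real.exp ((t - m) * Y x)) γ :=
    integrable_of_bounded (C := Real.exp ((t - m) * C)) (by fun_prop) fun x => by
      rw [abs_of_pos (Real.exp_pos _)]
      exact Real.exp_le_exp.2 (mul_le_mul_of_nonneg_left (abs_le.1 (hC x)).2 hθ)
  have h1 := measure_ge_le_exp_mul_mgf (μ := γ) (X := Y) t hθ hexpi
  have h2 := integral_exp_mul_lipschitz_le hY hC hL hθ
  have h3 : γ.real {x | t ≤ Y x} ≤ 1 - stdPhi t := by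
    refine (h1.trans (mul_le_mul_of_nonneg_left h2 (Real.exp_pos _).le)).trans ?_
    refine le_trans ?_ (exp_neg_sq_le_one_sub_stdPhi ht)
    rw [← Real.exp_add, ← hm']
    refine Real.exp_le_exp.2 ?_
    nlinarith
  calc γ {x | t < Y x} ≤ γ {x | t ≤ Y x} := measure_mono fun x (hx : t < Y x) => hx.le
    _ = ENNReal.ofReal (γ.real {x | t ≤ Y x}) := (ofReal_measureReal).symm
    _ ≤ _ := ENNReal.ofReal_le_ofReal h3

theorem exists_perm_antitone {p : ℕ} (g : Fin p → ℝ) :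
    ∃ τ : Equiv.Perm (Fin p), Antitone fun j => g (τ j) :=
  ⟨Tuple.sort fun i => -g i, fun _ _ hab =>
    neg_le_neg_iff.1 (Tuple.monotone_sort (fun i => -g i) hab)⟩

theorem rearr_eq_of_antitone {p : ℕ} {u : Fin p → ℝ} {τ : Equiv.Perm (Fin p)}
    (hτ : Antitone fun j => |u (τ j)|) (j : Fin p) : rearr u j = |u (τ j)| := by
  have h : (Finset.univ.val.map fun i => |u i|).sort (· ≥ ·) = List.ofFn fun j => |u (τ j)| := by
    refine List.Perm.eq_of_pairwise' (r := (· ≥ ·)) (Multiset.pairwise_sort _ _)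
      hτ.sortedGE_ofFn.pairwise ?_
    rw [← Multiset.coe_eq_coe, Multiset.sort_eq, Fin.univ_val_map, Multiset.coe_eq_coe]
    exact (τ.ofFn_comp_perm fun i => |u i|).symm
  rw [rearr, h]
  simp [List.getD]

theorem exists_perm_rearr {p : ℕ} (u : Fin p → ℝ) :
    ∃ τ : Equiv.Perm (Fin p), ∀ j, rearr u j = |u (τ j)| := by
  obtain ⟨τ, hτ⟩ := exists_perm_antitone fun i => |u i|
  exact ⟨τ, rearr_eq_of_antitone hτ⟩

theorem rearr_antitone {p : ℕ} (u : Fin p → ℝ) : Antitone (rearr u) := by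
  obtain ⟨τ, hτ⟩ := exists_perm_antitone fun i => |u i|
  rwa [funext (rearr_eq_of_antitone hτ)]

theorem rearr_nonneg {p : ℕ} (u : Fin p → ℝ) (j : Fin p) : 0 ≤ rearr u j := by
  obtain ⟨τ, hτ⟩ := exists_perm_rearr u
  rw [hτ]
  exact abs_nonneg _

theorem sum_comp_rearr {p : ℕ} (u : Fin p → ℝ) (φ : ℝ → ℝ) :
    ∑ j, φ (rearr u j) = ∑ i, φ |u i| := by
  obtain ⟨τ, hτ⟩ := exists_perm_rearr u
  simp_rw [hτ]
  exact Equiv.sum_comp τ fun i => φ |u i|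

theorem sum_mul_abs_perm_le {p : ℕ} {w : Fin p → ℝ} (hw : Antitone w) (u : Fin p → ℝ)
    (π : Equiv.Perm (Fin p)) : ∑ j, w j * |u (π j)| ≤ ∑ j, w j * rearr u j := by
  obtain ⟨τ, hτ⟩ := exists_perm_rearr u
  have hmono : Monovary w (rearr u) := hw.monovary (rearr_antitone u)
  have h := hmono.sum_mul_comp_perm_le_sum_mul (σ := π.trans τ.symm)
  simpa [hτ] using h

theorem rearr_le_of_card_le {p : ℕ} {u : Fin p → ℝ} {v : ℝ} {j : Fin p}
    (h : (Finset.univ.filter fun i => v < |u i|).card ≤ (j : ℕ)) : rearr u j ≤ v := by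
  by_contra! hlt
  obtain ⟨τ, hτ⟩ := exists_perm_rearr u
  have hsub : (Finset.Iic j).map τ.toEmbedding ⊆ Finset.univ.filter fun i => v < |u i| := by
    intro i hi
    obtain ⟨k, hk, rfl⟩ := Finset.mem_map.1 hi
    simp only [Finset.mem_filter, Finset.mem_univ, true_and]
    exact hlt.trans_le ((rearr_antitone u (Finset.mem_Iic.1 hk)).trans_eq (hτ k))
  have := Finset.card_le_card hsub
  rw [Finset.card_map, Fin.card_Iic] at this
  omega

theorem sum_mul_le_sum_rearr_mul {p : ℕ} (g u : Fin p → ℝ) :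
    ∑ i, g i * u i ≤ ∑ j, rearr g j * rearr u j := by
  obtain ⟨τ, hτ⟩ := exists_perm_rearr u
  calc ∑ i, g i * u i ≤ ∑ i, |g i| * |u i| :=
        Finset.sum_le_sum fun i _ => (le_abs_self _).trans_eq (abs_mul _ _)
    _ = ∑ j, rearr u j * |g (τ j)| := by
        rw [← Equiv.sum_comp τ]
        exact Finset.sum_congr rfl fun j _ => by rw [hτ, mul_comm]
    _ ≤ ∑ j, rearr u j * rearr g j := sum_mul_abs_perm_le (rearr_antitone u) g τ
    _ = _ := Finset.sum_congr rfl fun j _ => mul_comm _ _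

theorem log_two_le_log_two_mul_div {p : ℕ} (j : Fin p) :
    Real.log 2 ≤ Real.log (2 * p / ((j : ℕ) + 1)) := by
  refine Real.log_le_log two_pos ?_
  rw [le_div_iff₀ (by positivity)]
  have : ((j : ℕ) : ℝ) + 1 ≤ p := by exact_mod_cast j.2
  linarith

theorem muW_nonneg {σ : ℝ} (hσ : 0 ≤ σ) (n : ℕ) {p : ℕ} (j : Fin p) : 0 ≤ muW σ n j :=
  mul_nonneg hσ (Real.sqrt_nonneg _)

theorem muW_antitone {σ : ℝ} (hσ : 0 ≤ σ) (n p : ℕ) : Antitone (muW σ n : Fin p → ℝ) := by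
  intro j k hjk
  have hp : (0 : ℝ) < p := by exact_mod_cast j.pos
  have : ((j : ℕ) : ℝ) ≤ (k : ℕ) := by exact_mod_cast hjk
  unfold muW
  gcongr

theorem muW_sq {σ : ℝ} (n : ℕ) {p : ℕ} (j : Fin p) :
    muW σ n j ^ 2 = σ ^ 2 / n * Real.log (2 * p / ((j : ℕ) + 1)) := by
  have h := (Real.log_pos one_lt_two).le.trans (log_two_le_log_two_mul_div j)
  rw [muW, mul_pow, Real.sq_sqrt (by positivity)]
  ring

theorem slopeNorm_convex {σ : ℝ} (hσ : 0 ≤ σ) (n : ℕ) {p : ℕ} (u v : Fin p → ℝ) {t : ℝ}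
    (ht0 : 0 ≤ t) (ht1 : t ≤ 1) :
    slopeNorm σ n (u + t • (v - u)) ≤ slopeNorm σ n u + t * (slopeNorm σ n v - slopeNorm σ n u) := by
  obtain ⟨τ, hτ⟩ := exists_perm_rearr (u + t • (v - u))
  have hu := sum_mul_abs_perm_le (muW_antitone hσ n p) u τ
  have hv := sum_mul_abs_perm_le (muW_antitone hσ n p) v τ
  have h : slopeNorm σ n (u + t • (v - u)) ≤
      (1 - t) * ∑ j, muW σ n j * |u (τ j)| + t * ∑ j, muW σ n j * |v (τ j)| := by
    rw [slopeNorm, Finset.mul_sum, Finset.mul_sum, ← Finset.sum_add_distrib]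
    refine Finset.sum_le_sum fun j _ => ?_
    rw [hτ]
    have h1 : |(u + t • (v - u)) (τ j)| ≤ (1 - t) * |u (τ j)| + t * |v (τ j)| := by
      calc |(u + t • (v - u)) (τ j)| = |(1 - t) * u (τ j) + t * v (τ j)| := by
            simp only [Pi.add_apply, Pi.smul_apply, Pi.sub_apply, smul_eq_mul]
            congr 1
            ring
        _ ≤ _ := by
            refine (abs_add_le _ _).trans_eq ?_
            rw [abs_mul, abs_mul, abs_of_nonneg ht0, abs_of_nonneg (sub_nonneg.2 ht1)]
    have := mul_le_mul_of_nonneg_left h1 (muW_nonneg hσ n j)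
    linarith
  have h1 := mul_le_mul_of_nonneg_left hu (sub_nonneg.2 ht1)
  have h2 := mul_le_mul_of_nonneg_left hv ht0
  change _ ≤ _ * slopeNorm σ n u at h1
  change _ ≤ _ * slopeNorm σ n v at h2
  linarith

theorem slopeNorm_add_ge {σ : ℝ} (hσ : 0 ≤ σ) (n : ℕ) {p s : ℕ} {β : Fin p → ℝ}
    (hβ : {j | β j ≠ 0}.ncard ≤ s) (Δ : Fin p → ℝ) :
    slopeNorm σ n β
        - ∑ j ∈ Finset.univ.filter (fun j : Fin p => (j : ℕ) < s), muW σ n j * rearr Δ j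
        + ∑ j ∈ Finset.univ.filter (fun j : Fin p => s ≤ (j : ℕ)), muW σ n j * rearr Δ j
      ≤ slopeNorm σ n (β + Δ) := by
  set M := ∑ i, |Δ i|
  have hM : ∀ i, |Δ i| ≤ M := fun i =>
    Finset.single_le_sum (f := fun i => |Δ i|) (fun _ _ => abs_nonneg _) (Finset.mem_univ i)
  obtain ⟨π, hπ⟩ := exists_perm_antitone fun i => if β i = 0 then |Δ i| else M + |β i|
  have hβπ : Antitone fun j => |β (π j)| := by
    intro a b hab
    have h := hπ hab
    by_cases hb : β (π b) = 0
    · simp [hb]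
    · have hb' := abs_pos.2 hb
      by_cases ha : β (π a) = 0
      · simp only [ha, hb, if_true, if_false] at h
        linarith [hM (π a)]
      · simpa [ha, hb] using h
  have hzero : ∀ j : Fin p, s ≤ (j : ℕ) → β (π j) = 0 := by
    intro j hj
    by_contra hne
    have hsub : (((Finset.Iic j).map π.toEmbedding : Finset (Fin p)) : Set (Fin p)) ⊆
        {j | β j ≠ 0} := by
      intro i hi
      obtain ⟨k, hk, rfl⟩ := Finset.mem_map.1 (Finset.mem_coe.1 hi)
      exact abs_pos.1 ((abs_pos.2 hne).trans_le (hβπ (Finset.mem_Iic.1 hk)))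
    have := Set.ncard_le_ncard hsub (Set.toFinite _)
    rw [Set.ncard_coe_finset, Finset.card_map, Fin.card_Iic] at this
    omega
  have hΔ : ∀ j : Fin p, s ≤ (j : ℕ) → rearr Δ j ≤ |Δ (π j)| := by
    intro j hj
    refine rearr_le_of_card_le ?_
    have hsub : (Finset.univ.filter fun i => |Δ (π j)| < |Δ i|) ⊆
        (Finset.Iio j).map π.toEmbedding := by
      intro i hi
      refine Finset.mem_map.2 ⟨π.symm i, ?_, by simp⟩
      by_contra hle
      have hle' : j ≤ π.symm i := by simpa using hle
      have h := hπ hle'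
      have h1 := hzero _ (hj.trans hle')
      simp only [Equiv.apply_symm_apply] at h h1
      simp only [hzero j hj, h1, if_true] at h
      exact absurd (Finset.mem_filter.1 hi).2 h.not_gt
    exact (Finset.card_le_card hsub).trans (by simp)
  have hw : Antitone fun j : Fin p => if (j : ℕ) < s then muW σ n j else 0 := by
    intro a b hab
    have hab' : (a : ℕ) ≤ b := hab
    dsimp only
    split_ifs with h1 h2 h2
    · exact muW_antitone hσ n p hab
    · omega
    · exact muW_nonneg hσ n a
    · exact le_rfl
  have h1 := sum_mul_abs_perm_le hw Δ π
  have h2 := sum_mul_abs_perm_le (muW_antitone hσ n p) (β + Δ) π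
  refine le_trans ?_ h2
  have h3 : slopeNorm σ n β = ∑ j, muW σ n j * |β (π j)| :=
    Finset.sum_congr rfl fun j _ => by rw [rearr_eq_of_antitone hβπ]
  rw [Finset.sum_filter, Finset.sum_filter, h3]
  have h4 : ∑ j, muW σ n j * |β (π j)| -
      ∑ j : Fin p, (if (j : ℕ) < s then muW σ n j else 0) * |Δ (π j)| +
      ∑ j : Fin p, (if s ≤ (j : ℕ) then muW σ n j * rearr Δ j else 0) ≤
      ∑ j, muW σ n j * |(β + Δ) (π j)| := by
    rw [← Finset.sum_sub_distrib, ← Finset.sum_add_distrib]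
    refine Finset.sum_le_sum fun j _ => ?_
    have hμ := muW_nonneg hσ n j
    rcases lt_or_ge (j : ℕ) s with hj | hj
    · rw [if_pos hj, if_neg (by omega), add_zero, ← mul_sub]
      refine mul_le_mul_of_nonneg_left ?_ hμ
      have := abs_sub_abs_le_abs_sub (β (π j)) (-Δ (π j))
      rw [abs_neg, sub_neg_eq_add] at this
      exact this
    · rw [if_neg (by omega), if_pos hj, Pi.add_apply, hzero j hj]
      simpa using mul_le_mul_of_nonneg_left (hΔ j hj) hμ
  simp only [ite_mul, zero_mul] at h1 h4
  linarith

theorem sum_filter_muW_sq {σ : ℝ} (n : ℕ) {p s : ℕ} (hs : s ≤ p) :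
    ∑ j ∈ Finset.univ.filter (fun j : Fin p => (j : ℕ) < s), muW σ n j ^ 2 =
      σ ^ 2 / n * ∑ k ∈ Finset.range s, Real.log (2 * p / (k + 1)) := by
  simp_rw [muW_sq, ← Finset.mul_sum]
  rw [Finset.sum_filter,
    Fin.sum_univ_eq_sum_range (fun k => if k < s then Real.log (2 * p / (k + 1)) else 0),
    ← Finset.sum_filter]
  congr 2
  ext k
  simp only [Finset.mem_filter, Finset.mem_range]
  omega

theorem sum_filter_muW_sq_le {σ : ℝ} (n : ℕ) {p s : ℕ} (hs1 : 1 ≤ s) (hs : s ≤ p) :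
    ∑ j ∈ Finset.univ.filter (fun j : Fin p => (j : ℕ) < s), muW σ n j ^ 2 ≤
      σ ^ 2 / n * (s * Real.log (2 * Real.exp 1 * p / s)) := by
  rw [sum_filter_muW_sq n hs]
  have hs0 : (0 : ℝ) < s := by exact_mod_cast hs1
  have hp0 : (0 : ℝ) < p := by exact_mod_cast hs1.trans hs
  have hfac : (0 : ℝ) < s.factorial := by exact_mod_cast s.factorial_pos
  gcongr
  rw [← Real.log_prod fun k _ => by positivity, ← Real.log_pow, Finset.prod_div_distrib,
    Finset.prod_const, Finset.card_range]
  have h1 : ∏ k ∈ Finset.range s, ((k : ℝ) + 1) = s.factorial := by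
    rw [← Finset.prod_range_add_one_eq_factorial]
    push_cast
    rfl
  rw [h1]
  refine Real.log_le_log (by positivity) ?_
  have h2 := Real.pow_div_factorial_le_exp (s : ℝ) hs0.le s
  rw [div_le_iff₀ hfac] at h2
  rw [div_pow, mul_right_comm, mul_pow _ (Real.exp 1), ← Real.exp_nat_mul, mul_one,
    div_le_div_iff₀ hfac (by positivity)]
  have h3 := mul_le_mul_of_nonneg_left h2 (by positivity : 0 ≤ (2 * (p : ℝ)) ^ s)
  linarith

theorem log_two_le_sum_filter_muW_sq {σ : ℝ} (n : ℕ) {p s : ℕ} (hs1 : 1 ≤ s) (hs : s ≤ p) :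
    σ ^ 2 / n * Real.log 2 ≤
      ∑ j ∈ Finset.univ.filter (fun j : Fin p => (j : ℕ) < s), muW σ n j ^ 2 := by
  have h := Finset.single_le_sum (f := fun j => muW σ n j ^ 2)
    (s := Finset.univ.filter (fun j : Fin p => (j : ℕ) < s)) (fun _ _ => sq_nonneg _)
    (a := ⟨0, hs1.trans hs⟩) (by simp; omega)
  refine le_trans ?_ h
  simp only [muW_sq]
  exact mul_le_mul_of_nonneg_left (log_two_le_log_two_mul_div ⟨0, hs1.trans hs⟩)
    (by positivity)

theorem rearr_le_of_sum_exp {p : ℕ} (g : Fin p → ℝ) (j : Fin p) :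
    rearr g j ≤ √(8 / 3 * max 1 (1 + Real.log ((∑ i, Real.exp (3 / 8 * g i ^ 2)) / (2 * p)) /
      Real.log 2)) * √(Real.log (2 * p / ((j : ℕ) + 1))) := by
  set T := ∑ i, Real.exp (3 / 8 * g i ^ 2)
  set L := Real.log (2 * p / ((j : ℕ) + 1))
  set K := max 1 (1 + Real.log (T / (2 * p)) / Real.log 2)
  have hp : (0 : ℝ) < p := by exact_mod_cast j.pos
  have hlog2 : 0 < Real.log 2 := Real.log_pos one_lt_two
  have hL : Real.log 2 ≤ L := log_two_le_log_two_mul_div j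
  have hK1 : 1 ≤ K := le_max_left _ _
  have hsum : ((j : ℕ) + 1) * Real.exp (3 / 8 * rearr g j ^ 2) ≤ T := by
    have h1 : T = ∑ k, Real.exp (3 / 8 * rearr g k ^ 2) := by
      rw [sum_comp_rearr g fun x => Real.exp (3 / 8 * x ^ 2)]
      simp_rw [sq_abs]
      rfl
    rw [h1]
    calc ((j : ℕ) + 1) * Real.exp (3 / 8 * rearr g j ^ 2)
        = ∑ k ∈ Finset.Iic j, Real.exp (3 / 8 * rearr g j ^ 2) := by simp
      _ ≤ ∑ k ∈ Finset.Iic j, Real.exp (3 / 8 * rearr g k ^ 2) := by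
          refine Finset.sum_le_sum fun k hk => ?_
          have h2 := rearr_antitone g (Finset.mem_Iic.1 hk)
          have h3 := rearr_nonneg g j
          gcongr
      _ ≤ _ := Finset.sum_le_sum_of_subset_of_nonneg (Finset.subset_univ _)
          fun _ _ _ => (Real.exp_pos _).le
  have hTpos : 0 < T := lt_of_lt_of_le (by positivity) hsum
  have hlog : 3 / 8 * rearr g j ^ 2 ≤ L + Real.log (T / (2 * p)) := by
    rw [← Real.log_mul (by positivity) (by positivity), Real.le_log_iff_exp_le (by positivity)]
    have h3 : 2 * (p : ℝ) / ((j : ℕ) + 1) * (T / (2 * p)) = T / ((j : ℕ) + 1) := by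
      field_simp
    rw [h3, le_div_iff₀ (by positivity)]
    linarith
  have hU : Real.log (T / (2 * p)) ≤ (K - 1) * Real.log 2 := by
    rw [← div_le_iff₀ hlog2]
    have := le_max_right 1 (1 + Real.log (T / (2 * p)) / Real.log 2)
    linarith
  have hKL := mul_le_mul_of_nonneg_left hL (by linarith : 0 ≤ K - 1)
  rw [← Real.sqrt_mul (by positivity)]
  exact Real.le_sqrt_of_sq_le (by linarith)

theorem sum_mul_le_slopeNorm {σ : ℝ} (hσ : 0 ≤ σ) (n : ℕ) {p : ℕ} (g u : Fin p → ℝ) :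
    σ / √n * ∑ j, g j * u j ≤ √(8 / 3 * max 1 (1 + Real.log ((∑ i, Real.exp (3 / 8 * g i ^ 2)) /
      (2 * p)) / Real.log 2)) * slopeNorm σ n u := by
  refine (mul_le_mul_of_nonneg_left (sum_mul_le_sum_rearr_mul g u) (by positivity)).trans ?_
  rw [slopeNorm, Finset.mul_sum, Finset.mul_sum]
  refine Finset.sum_le_sum fun j _ => ?_
  have h := mul_le_mul_of_nonneg_left (mul_le_mul_of_nonneg_right (rearr_le_of_sum_exp g j)
    (rearr_nonneg u j)) (by positivity : 0 ≤ σ / √n)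
  refine h.trans_eq ?_
  rw [muW, Real.sqrt_div' _ (Nat.cast_nonneg n)]
  ring

theorem scaledNorm_nonneg {n : ℕ} (u : Fin n → ℝ) : 0 ≤ scaledNorm u := Real.sqrt_nonneg _

theorem scaledNorm_sq {n : ℕ} (u : Fin n → ℝ) : scaledNorm u ^ 2 = (∑ i, u i ^ 2) / n :=
  Real.sq_sqrt (by positivity)

theorem first_order_of_minimizer {n p : ℕ} {σ : ℝ} (hσ : 0 ≤ σ) {X : Matrix (Fin n) (Fin p) ℝ}
    {A : ℝ} (hA : 0 ≤ A) {y : Fin n → ℝ} {b : Fin p → ℝ}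
    (hb : ∀ v : Fin p → ℝ, scaledNorm (y - X.mulVec b) ^ 2 + 2 * A * slopeNorm σ n b
        ≤ scaledNorm (y - X.mulVec v) ^ 2 + 2 * A * slopeNorm σ n v) (v : Fin p → ℝ) :
    (∑ i, (y - X.mulVec b) i * X.mulVec (v - b) i) / n ≤
      A * (slopeNorm σ n v - slopeNorm σ n b) := by
  set I := (∑ i, (y - X.mulVec b) i * X.mulVec (v - b) i) / n with hI
  set M := scaledNorm (X.mulVec (v - b)) ^ 2 with hM
  set c := 2 * I - 2 * (A * (slopeNorm σ n v - slopeNorm σ n b)) with hc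
  have key : ∀ t : ℝ, 0 < t → t ≤ 1 → c ≤ t * M := by
    intro t ht0 ht1
    have h1 := hb (b + t • (v - b))
    have h2 := mul_le_mul_of_nonneg_left (slopeNorm_convex hσ n b v ht0.le ht1) hA
    have h3 : scaledNorm (y - X.mulVec (b + t • (v - b))) ^ 2 =
        scaledNorm (y - X.mulVec b) ^ 2 - 2 * t * I + t ^ 2 * M := by
      rw [hI, hM, scaledNorm_sq, scaledNorm_sq, scaledNorm_sq, ← mul_div_assoc, ← mul_div_assoc,
        ← sub_div, ← add_div, Finset.mul_sum, Finset.mul_sum, ← Finset.sum_sub_distrib,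
        ← Finset.sum_add_distrib]
      congr 1
      refine Finset.sum_congr rfl fun i _ => ?_
      rw [Matrix.mulVec_add, Matrix.mulVec_smul]
      simp only [Pi.sub_apply, Pi.add_apply, Pi.smul_apply, smul_eq_mul]
      ring
    have h4 : t * c ≤ t * (t * M) := by
      rw [hc]
      nlinarith
    exact le_of_mul_le_mul_left h4 ht0
  suffices c ≤ 0 by linarith
  by_contra! hpos
  have h1 := key 1 one_pos le_rfl
  have hMpos : 0 < M := by linarith
  have h2 := key (c / (2 * M)) (by positivity) (by rw [div_le_one (by positivity)]; linarith)
  have h3 : c / (2 * M) * M = c / 2 := by field_simp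
  linarith

theorem sum_sq_prediction_sub_le {n p : ℕ} {σ : ℝ} (hσ : 0 ≤ σ) {X : Matrix (Fin n) (Fin p) ℝ}
    {A : ℝ} (hA : 0 ≤ A) {y y' : Fin n → ℝ} {b b' : Fin p → ℝ} (hn : 0 < n)
    (hb : ∀ v : Fin p → ℝ, scaledNorm (y - X.mulVec b) ^ 2 + 2 * A * slopeNorm σ n b
        ≤ scaledNorm (y - X.mulVec v) ^ 2 + 2 * A * slopeNorm σ n v)
    (hb' : ∀ v : Fin p → ℝ, scaledNorm (y' - X.mulVec b') ^ 2 + 2 * A * slopeNorm σ n b'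
        ≤ scaledNorm (y' - X.mulVec v) ^ 2 + 2 * A * slopeNorm σ n v) :
    ∑ i, (X.mulVec b - X.mulVec b') i ^ 2 ≤ ∑ i, (y i - y' i) ^ 2 := by
  have h1 := first_order_of_minimizer hσ hA hb b'
  have h2 := first_order_of_minimizer hσ hA hb' b
  have h3 := add_le_add h1 h2
  have hn' : (0 : ℝ) < n := by exact_mod_cast hn
  rw [← add_div, ← Finset.sum_add_distrib, div_le_iff₀ hn'] at h3
  have h4 : ∑ i, ((X.mulVec b - X.mulVec b') i ^ 2 - (y i - y' i) ^ 2) ≤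
      2 * ∑ i, ((y - X.mulVec b) i * X.mulVec (b' - b) i +
        (y' - X.mulVec b') i * X.mulVec (b - b') i) := by
    rw [Finset.mul_sum]
    refine Finset.sum_le_sum fun i _ => ?_
    rw [Matrix.mulVec_sub, Matrix.mulVec_sub]
    simp only [Pi.sub_apply]
    nlinarith [sq_nonneg (y i - y' i - (X.mulVec b i - X.mulVec b' i))]
  rw [Finset.sum_sub_distrib] at h4
  linarith

theorem thetaSq_mul_le {n p : ℕ} {X : Matrix (Fin n) (Fin p) ℝ} {σ : ℝ} {s : ℕ} {c₀ : ℝ}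
    {Δ : Fin p → ℝ}
    (h : (∑ j ∈ Finset.univ.filter (fun j : Fin p => s ≤ (j : ℕ)), muW σ n j * rearr Δ j)
      ≤ c₀ * √(∑ j ∈ Finset.univ.filter (fun j : Fin p => (j : ℕ) < s), muW σ n j ^ 2) *
        √(∑ j, Δ j ^ 2)) :
    thetaSq X σ s c₀ * ∑ j, Δ j ^ 2 ≤ scaledNorm (X.mulVec Δ) ^ 2 := by
  by_cases hΔ : Δ = 0
  · simp [hΔ, sq_nonneg]
  · have hpos : 0 < ∑ j, Δ j ^ 2 := by
      obtain ⟨j, hj⟩ := Function.ne_iff.1 hΔ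
      exact Finset.sum_pos' (fun _ _ => sq_nonneg _)
        ⟨j, Finset.mem_univ j, sq_pos_of_ne_zero hj⟩
    rw [← le_div_iff₀ hpos]
    refine csInf_le ⟨0, ?_⟩ ⟨Δ, hΔ, h, rfl⟩
    rintro r ⟨Δ', -, -, rfl⟩
    positivity

theorem thetaSq_le_one {n p : ℕ} {X : Matrix (Fin n) (Fin p) ℝ} {σ : ℝ}
    (hdiag : ∀ j : Fin p, (1 / n) * ∑ i, X i j ^ 2 ≤ 1) {s : ℕ} (hs1 : 1 ≤ s) (hs : s ≤ p)
    {c₀ : ℝ} (hc₀ : 0 ≤ c₀) : thetaSq X σ s c₀ ≤ 1 := by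
  set i₀ : Fin p := ⟨0, hs1.trans hs⟩
  have hcone : (∑ j ∈ Finset.univ.filter (fun j : Fin p => s ≤ (j : ℕ)),
      muW σ n j * rearr (Pi.single i₀ (1 : ℝ)) j)
      ≤ c₀ * √(∑ j ∈ Finset.univ.filter (fun j : Fin p => (j : ℕ) < s), muW σ n j ^ 2) *
        √(∑ j, (Pi.single i₀ (1 : ℝ) : Fin p → ℝ) j ^ 2) := by
    rw [Finset.sum_eq_zero]
    · positivity
    · intro j hj
      have hj' := (Finset.mem_filter.1 hj).2
      have h0 : rearr (Pi.single i₀ (1 : ℝ) : Fin p → ℝ) j ≤ 0 := by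
        refine rearr_le_of_card_le (le_trans (Finset.card_le_card (t := {i₀}) ?_) ?_)
        · intro i hi
          by_contra hne
          rw [Finset.mem_singleton] at hne
          simp [hne] at hi
        · rw [Finset.card_singleton]
          omega
      rw [le_antisymm h0 (rearr_nonneg _ _), mul_zero]
  have h := thetaSq_mul_le (X := X) hcone
  have h1 : ∑ j, (Pi.single i₀ (1 : ℝ) : Fin p → ℝ) j ^ 2 = 1 := by
    simp [Pi.single_apply]
  rw [h1, mul_one, scaledNorm_sq] at h
  refine h.trans (le_trans (le_of_eq ?_) (hdiag i₀))
  simp [div_eq_inv_mul]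

theorem prediction_error_le {n p : ℕ} {σ : ℝ} (hσ : 0 < σ) {f ξ : Fin n → ℝ}
    {X : Matrix (Fin n) (Fin p) ℝ} (hdiag : ∀ j : Fin p, (1 / n) * ∑ i, X i j ^ 2 ≤ 1)
    {A : ℝ} (hA : 8 ≤ A) {b : Fin p → ℝ}
    (hb : ∀ v : Fin p → ℝ, scaledNorm (f + ξ - X.mulVec b) ^ 2 + 2 * A * slopeNorm σ n b
        ≤ scaledNorm (f + ξ - X.mulVec v) ^ 2 + 2 * A * slopeNorm σ n v)
    {κ : ℝ} (hκ0 : 0 ≤ κ) (hκ : κ ≤ 4)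
    (hξ : ∀ u : Fin p → ℝ, (∑ i, ξ i * X.mulVec u i) / n ≤ κ * slopeNorm σ n u)
    {s : ℕ} (hs1 : 1 ≤ s) (hs : s ≤ p) {β : Fin p → ℝ} (hβ : {j | β j ≠ 0}.ncard ≤ s)
    (hθ : 0 < thetaSq X σ s 3) :
    scaledNorm (X.mulVec b - f) ≤ scaledNorm (X.mulVec β - f) +
      3 * σ * A * √(s * Real.log (2 * Real.exp 1 * p / s) / n) / (2 * √(thetaSq X σ s 3)) -
      √(Real.log 2) * (4 - κ) * (σ / √n) := by
  set Δ := b - β with hΔ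
  set S₁ := ∑ j ∈ Finset.univ.filter (fun j : Fin p => (j : ℕ) < s), muW σ n j * rearr Δ j with hS₁
  set S₂ := ∑ j ∈ Finset.univ.filter (fun j : Fin p => s ≤ (j : ℕ)), muW σ n j * rearr Δ j with hS₂
  set Q := ∑ j ∈ Finset.univ.filter (fun j : Fin p => (j : ℕ) < s), muW σ n j ^ 2
  set D := √(∑ j, Δ j ^ 2) with hD
  set F := scaledNorm (X.mulVec b - f)
  set B := scaledNorm (X.mulVec β - f)
  set τ := scaledNorm (X.mulVec Δ)
  set ϑ := √(thetaSq X σ s 3) with hϑ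
  have hB0 : 0 ≤ B := scaledNorm_nonneg _
  have hτ0 : 0 ≤ τ := scaledNorm_nonneg _
  have hϑ0 : 0 < ϑ := Real.sqrt_pos.2 hθ
  have hS₁0 : 0 ≤ S₁ := Finset.sum_nonneg fun j _ =>
    mul_nonneg (muW_nonneg hσ.le n j) (rearr_nonneg Δ j)
  have hS₁D : S₁ ≤ √Q * D := by
    refine (Real.sum_mul_le_sqrt_mul_sqrt _ _ _).trans ?_
    refine mul_le_mul_of_nonneg_left (Real.sqrt_le_sqrt ?_) (Real.sqrt_nonneg _)
    have h1 := sum_comp_rearr Δ fun x => x ^ 2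
    simp only [sq_abs] at h1
    rw [← h1]
    exact Finset.sum_le_sum_of_subset_of_nonneg (Finset.subset_univ _) fun _ _ _ => sq_nonneg _
  have hbasic : F ^ 2 ≤ B ^ 2 - τ ^ 2 + 2 * (A + κ) * S₁ - 2 * (A - κ) * S₂ := by
    have h1 := first_order_of_minimizer hσ.le (by linarith : 0 ≤ A) hb β
    have h2 := slopeNorm_add_ge hσ.le n hβ Δ
    rw [hΔ, add_sub_cancel, ← hΔ] at h2
    have h3 := hξ Δ
    have h4 : slopeNorm σ n Δ = S₁ + S₂ := by
      rw [slopeNorm, hS₁, hS₂,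
        ← Finset.sum_filter_add_sum_filter_not Finset.univ fun j : Fin p => (j : ℕ) < s]
      simp only [not_lt]
    rw [h4] at h3
    have h5 : F ^ 2 - B ^ 2 + τ ^ 2 = 2 * ((∑ i, ξ i * X.mulVec Δ i) / n +
        (∑ i, (f + ξ - X.mulVec b) i * X.mulVec (β - b) i) / n) := by
      simp only [F, B, τ]
      rw [scaledNorm_sq, scaledNorm_sq, scaledNorm_sq, ← add_div, ← sub_div, ← add_div,
        ← mul_div_assoc, ← Finset.sum_add_distrib, ← Finset.sum_sub_distrib,
        ← Finset.sum_add_distrib, Finset.mul_sum]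
      congr 1
      refine Finset.sum_congr rfl fun i _ => ?_
      rw [hΔ, Matrix.mulVec_sub, Matrix.mulVec_sub]
      simp only [Pi.sub_apply, Pi.add_apply]
      ring
    have h6 := mul_le_mul_of_nonneg_left (by linarith : slopeNorm σ n β - slopeNorm σ n b ≤ S₁ - S₂)
      (by linarith : 0 ≤ A)
    linarith
  set c := (A + κ) * (√Q / ϑ) with hc
  have hc0 : 0 ≤ c := by positivity
  have hFc : F ≤ B + c := by
    refine abs_le_of_sq_le_sq' ?_ (by positivity) |>.2
    by_cases hcone : S₂ ≤ 3 * √Q * D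
    · have h1 : ϑ * D ≤ τ := by
        refine (pow_le_pow_iff_left₀ (by positivity) hτ0 two_ne_zero).1 ?_
        rw [mul_pow, hϑ, hD, Real.sq_sqrt hθ.le, Real.sq_sqrt (by positivity)]
        exact thetaSq_mul_le hcone
      have h2 : (A + κ) * S₁ ≤ c * τ := by
        calc (A + κ) * S₁ ≤ (A + κ) * (√Q * D) := by gcongr
          _ = c * (ϑ * D) := by rw [hc]; field_simp
          _ ≤ c * τ := by gcongr
      have h3 : 0 ≤ (A - κ) * S₂ := mul_nonneg (by linarith) (Finset.sum_nonneg fun j _ =>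
        mul_nonneg (muW_nonneg hσ.le n j) (rearr_nonneg Δ j))
      nlinarith [sq_nonneg (c - τ), mul_nonneg hB0 hc0]
    · push Not at hcone
      have h1 : 3 * S₁ ≤ S₂ := by linarith
      have h2 := mul_le_mul_of_nonneg_left h1 (by linarith : 0 ≤ A - κ)
      have h3 : (A + κ) * S₁ ≤ (A - κ) * (3 * S₁) := by nlinarith
      nlinarith [sq_nonneg τ, mul_nonneg hB0 hc0, sq_nonneg c]
  have hϑ1 : ϑ ≤ 1 := Real.sqrt_le_one.2 (thetaSq_le_one hdiag hs1 hs (by norm_num))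
  have hQlow : √(Real.log 2) * (σ / √n) ≤ √Q / ϑ := by
    have h1 : √(Real.log 2) * (σ / √n) ≤ √Q := by
      refine Real.le_sqrt_of_sq_le (le_trans (le_of_eq ?_) (log_two_le_sum_filter_muW_sq n hs1 hs))
      rw [mul_pow, div_pow, Real.sq_sqrt (Real.log_pos one_lt_two).le,
        Real.sq_sqrt (Nat.cast_nonneg n), mul_comm]
    exact h1.trans (le_div_self (Real.sqrt_nonneg _) hϑ0 hϑ1)
  have hQup : √Q ≤ σ * √(s * Real.log (2 * Real.exp 1 * p / s) / n) := by
    have h1 := Real.sqrt_le_sqrt (sum_filter_muW_sq_le (σ := σ) n hs1 hs)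
    rwa [div_mul_eq_mul_div, mul_div_assoc, Real.sqrt_mul (sq_nonneg σ), Real.sqrt_sq hσ.le] at h1
  have hfin : 3 * A / 2 * (√Q / ϑ) ≤
      3 * σ * A * √(s * Real.log (2 * Real.exp 1 * p / s) / n) / (2 * ϑ) := by
    rw [← mul_div_assoc, div_le_div_iff₀ hϑ0 (by positivity)]
    have h1 := mul_le_mul_of_nonneg_left hQup (by positivity : 0 ≤ 3 * A * ϑ)
    linarith
  have h1 := mul_le_mul_of_nonneg_left hQlow (by linarith : 0 ≤ 4 - κ)
  have h2 : (A + κ + (4 - κ)) * (√Q / ϑ) ≤ 3 * A / 2 * (√Q / ϑ) := by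
    have : 0 ≤ √Q / ϑ := by positivity
    gcongr
    linarith
  linarith

theorem map_sum_const_mul_stdGaussian {n : ℕ} (a : Fin n → ℝ) :
    (Measure.pi fun _ : Fin n => gaussianReal 0 1).map (fun z => ∑ i, a i * z i) =
      gaussianReal 0 (∑ i, a i ^ 2).toNNReal := by
  set γ := Measure.pi fun _ : Fin n => gaussianReal 0 1
  have hmeas : ∀ i : Fin n, Measurable fun z : Fin n → ℝ => a i * z i := fun i => by fun_prop
  have hind : iIndepFun (fun (i : Fin n) (z : Fin n → ℝ) => a i * z i) γ :=
    iIndepFun_pi (X := fun i x => a i * x) fun i => by fun_prop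
  have hone : ∀ i, γ.map (fun z : Fin n → ℝ => a i * z i) =
      gaussianReal 0 (a i ^ 2).toNNReal := by
    intro i
    have h1 := gaussianReal_map_const_mul (μ := 0) (v := 1) (a i)
    have h2 : γ.map (Function.eval i) = gaussianReal 0 1 :=
      (measurePreserving_eval (fun _ : Fin n => gaussianReal 0 1) i).map_eq
    rw [← h2, Measure.map_map (measurable_const_mul (a i)) (measurable_pi_apply i), mul_zero,
      mul_one] at h1
    rw [Real.toNNReal_of_nonneg (sq_nonneg (a i))]
    exact h1
  have hsum : ∀ s : Finset (Fin n),
      γ.map (∑ i ∈ s, fun z : Fin n → ℝ => a i * z i) =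
        gaussianReal 0 (∑ i ∈ s, a i ^ 2).toNNReal := by
    intro s
    induction s using Finset.induction_on with
    | empty =>
      rw [Finset.sum_empty, Finset.sum_empty, Real.toNNReal_zero, gaussianReal_zero_var]
      exact (Measure.map_const γ (0 : ℝ)).trans (by simp)
    | insert i s hi ih =>
      rw [Finset.sum_insert hi, Finset.sum_insert hi, add_comm, add_comm (a i ^ 2),
        Real.toNNReal_add (by positivity) (sq_nonneg _)]
      simpa using gaussianReal_add_gaussianReal_of_indepFun
        (hind.indepFun_finsetSum_of_notMem hmeas hi) ih (hone i)
  rw [← hsum]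
  congr 1
  funext z
  simp

theorem exp_sq_mul_stdGaussianPDF (x : ℝ) :
    Real.exp (3 / 8 * x ^ 2) * gaussianPDFReal 0 1 x =
      (√(2 * Real.pi))⁻¹ * Real.exp (-(1 / 8) * x ^ 2) := by
  rw [stdGaussianPDF_eq, mul_left_comm, ← Real.exp_add]
  congr 2
  ring

theorem integrable_exp_sq_stdGaussian :
    Integrable (fun x : ℝ => Real.exp (3 / 8 * x ^ 2)) (gaussianReal 0 1) := by
  rw [integrable_gaussianReal_iff]
  simp_rw [exp_sq_mul_stdGaussianPDF]
  exact (integrable_exp_neg_mul_sq (by norm_num)).const_mul _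

theorem integral_exp_sq_stdGaussian :
    ∫ x, Real.exp (3 / 8 * x ^ 2) ∂(gaussianReal 0 1) = 2 := by
  rw [integral_stdGaussian_eq]
  simp_rw [exp_sq_mul_stdGaussianPDF]
  rw [integral_const_mul, integral_gaussian,
    show Real.pi / (1 / 8) = 2 ^ 2 * (2 * Real.pi) by ring,
    Real.sqrt_mul (sq_nonneg 2) (2 * Real.pi),
    Real.sqrt_sq two_pos.le]
  have : 0 < √(2 * Real.pi) := by positivity
  field_simp

theorem exp_sq_sum_const_mul {n : ℕ} {a : Fin n → ℝ} (ha : ∑ i, a i ^ 2 ≤ 1) :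
    Integrable (fun z => Real.exp (3 / 8 * (∑ i, a i * z i) ^ 2))
        (Measure.pi fun _ : Fin n => gaussianReal 0 1) ∧
      ∫ z, Real.exp (3 / 8 * (∑ i, a i * z i) ^ 2)
        ∂(Measure.pi fun _ : Fin n => gaussianReal 0 1) ≤ 2 := by
  set γ := Measure.pi fun _ : Fin n => gaussianReal 0 1
  set v := ∑ i, a i ^ 2
  have hv : 0 ≤ v := by positivity
  have hmap : γ.map (fun z => ∑ i, a i * z i) = (gaussianReal 0 1).map (√v * ·) := by
    rw [gaussianReal_map_const_mul, map_sum_const_mul_stdGaussian, mul_zero, mul_one,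
      Real.toNNReal_of_nonneg hv]
    congr 2
    exact (Real.sq_sqrt hv).symm
  have hcont : Continuous fun x : ℝ => Real.exp (3 / 8 * x ^ 2) := by fun_prop
  have hle : ∀ x : ℝ, Real.exp (3 / 8 * (√v * x) ^ 2) ≤ Real.exp (3 / 8 * x ^ 2) := by
    intro x
    rw [mul_pow, Real.sq_sqrt hv]
    have := mul_le_mul_of_nonneg_right ha (sq_nonneg x)
    exact Real.exp_le_exp.2 (by linarith)
  have hint : Integrable (fun x : ℝ => Real.exp (3 / 8 * (√v * x) ^ 2)) (gaussianReal 0 1) :=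
    integrable_exp_sq_stdGaussian.mono' (by fun_prop) <| Filter.Eventually.of_forall fun x => by
      rw [Real.norm_of_nonneg (Real.exp_pos _).le]
      exact hle x
  have hmeas : Measurable fun z : Fin n → ℝ => ∑ i, a i * z i := by fun_prop
  constructor
  · have h := (integrable_map_measure (μ := gaussianReal 0 1) (f := (√v * ·))
      hcont.aestronglyMeasurable (by fun_prop)).2 hint
    rw [← hmap] at h
    exact (integrable_map_measure hcont.aestronglyMeasurable hmeas.aemeasurable).1 h
  · rw [← integral_map (μ := γ) (φ := fun z : Fin n → ℝ => ∑ i, a i * z i)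
      (f := fun x => Real.exp (3 / 8 * x ^ 2))
      hmeas.aemeasurable hcont.aestronglyMeasurable, hmap,
      integral_map (by fun_prop) hcont.aestronglyMeasurable, ← integral_exp_sq_stdGaussian]
    exact integral_mono hint integrable_exp_sq_stdGaussian hle

theorem normalized_exp_sq_moment {n p : ℕ} (hp : 0 < p) {a : Fin p → Fin n → ℝ}
    (ha : ∀ j, ∑ i, a j i ^ 2 ≤ 1) :
    Integrable (fun z => (∑ j, Real.exp (3 / 8 * (∑ i, a j i * z i) ^ 2)) / (2 * p))
        (Measure.pi fun _ : Fin n => gaussianReal 0 1) ∧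
      ∫ z, (∑ j, Real.exp (3 / 8 * (∑ i, a j i * z i) ^ 2)) / (2 * p)
        ∂(Measure.pi fun _ : Fin n => gaussianReal 0 1) ≤ 1 ∧
      ∀ z : Fin n → ℝ, 1 / 2 ≤ (∑ j, Real.exp (3 / 8 * (∑ i, a j i * z i) ^ 2)) / (2 * p) := by
  have hp' : (0 : ℝ) < p := by exact_mod_cast hp
  refine ⟨(integrable_finsetSum _ fun j _ => (exp_sq_sum_const_mul (ha j)).1).div_const _, ?_,
    fun z => ?_⟩
  · rw [integral_div, integral_finsetSum _ fun j _ => (exp_sq_sum_const_mul (ha j)).1,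
      div_le_one (by positivity)]
    refine (Finset.sum_le_sum fun j _ => (exp_sq_sum_const_mul (ha j)).2).trans_eq ?_
    simp [mul_comm]
  · rw [div_le_div_iff₀ two_pos (by positivity)]
    have h := Finset.sum_le_sum (s := Finset.univ) fun (j : Fin p) _ =>
      Real.one_le_exp (x := 3 / 8 * (∑ i, a j i * z i) ^ 2) (by positivity)
    simp only [Finset.sum_const, Finset.card_univ, Fintype.card_fin, nsmul_eq_mul, mul_one] at h
    linarith

theorem scaledNorm_sub_scaledNorm_le {n : ℕ} (u v : Fin n → ℝ) :
    scaledNorm u - scaledNorm v ≤ √(∑ i, (u i - v i) ^ 2) / √n := by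
  have h := norm_sub_norm_le (WithLp.toLp 2 u : EuclideanSpace ℝ (Fin n)) (WithLp.toLp 2 v)
  simp only [EuclideanSpace.norm_eq, Real.norm_eq_abs, sq_abs, PiLp.sub_apply] at h
  rw [scaledNorm, scaledNorm, Real.sqrt_div' _ (Nat.cast_nonneg n),
    Real.sqrt_div' _ (Nat.cast_nonneg n), ← sub_div]
  gcongr

theorem continuous_of_sub_le_sqrt {n : ℕ} {Y : (Fin n → ℝ) → ℝ}
    (hL : ∀ x y, Y x - Y y ≤ √(∑ i, (x i - y i) ^ 2)) : Continuous Y := by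
  refine continuous_iff_continuousAt.2 fun y => tendsto_iff_dist_tendsto_zero.2 ?_
  have hcont : Continuous fun x : Fin n → ℝ => √(∑ i, (x i - y i) ^ 2) := by fun_prop
  have hlim : Filter.Tendsto (fun x : Fin n → ℝ => √(∑ i, (x i - y i) ^ 2)) (nhds y) (nhds 0) := by
    simpa using hcont.tendsto y
  refine squeeze_zero (fun _ => dist_nonneg) (fun x => ?_) hlim
  rw [Real.dist_eq]
  refine abs_sub_le_iff.2 ⟨hL x y, (hL y x).trans_eq ?_⟩
  congr 1
  exact Finset.sum_congr rfl fun i _ => by ring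

theorem gaussianVec_eq_map (n : ℕ) (σ : ℝ) :
    gaussianVec n σ =
      (Measure.pi fun _ : Fin n => gaussianReal 0 1).map fun z => σ • z := by
  have h : (gaussianReal 0 1).map (σ * ·) = gaussianReal 0 ⟨σ ^ 2, sq_nonneg σ⟩ := by
    rw [gaussianReal_map_const_mul, mul_zero, mul_one]
    rfl
  rw [gaussianVec, ← h]
  exact (Measure.pi_map_pi (μ := fun _ : Fin n => gaussianReal 0 1) (f := fun _ x => σ * x)
    fun _ => by fun_prop).symm

theorem integral_min_le_of_noise {n : ℕ} {G U : (Fin n → ℝ) → ℝ} {C : ℝ} (hC : ∀ x, -C ≤ G x)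
    (hL : ∀ x y, G x - G y ≤ √(∑ i, (x i - y i) ^ 2))
    (hU : Integrable U (Measure.pi fun _ : Fin n => gaussianReal 0 1)) (hUhalf : ∀ x, 1 / 2 ≤ U x)
    (hU1 : ∫ x, U x ∂(Measure.pi fun _ : Fin n => gaussianReal 0 1) ≤ 1)
    (hgood : ∀ x, U x ≤ 32 → G x ≤ -(√(Real.log 2) *
      (4 - √(8 / 3 * max 1 (1 + Real.log (U x) / Real.log 2))))) (N : ℝ) :
    (∀ x y, min (G x) N - min (G y) N ≤ √(∑ i, (x i - y i) ^ 2)) ∧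
    (∀ x, |min (G x) N| ≤ |C| + |N|) ∧
    ∫ x, min (G x) N ∂(Measure.pi fun _ : Fin n => gaussianReal 0 1) ≤ -(6 / 5) := by
  have hLN : ∀ x y, min (G x) N - min (G y) N ≤ √(∑ i, (x i - y i) ^ 2) := by
    intro x y
    have h0 := Real.sqrt_nonneg (∑ i, (x i - y i) ^ 2)
    have h1 := hL x y
    rcases le_total (G y) N with h | h
    · rw [min_eq_left h]
      linarith [min_le_left (G x) N]
    · rw [min_eq_right h]
      linarith [min_le_right (G x) N]
  have hb : ∀ x, |min (G x) N| ≤ |C| + |N| := by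
    intro x
    have h1 := neg_abs_le N
    have h2 := le_abs_self C
    have h3 := hC x
    have h4 := abs_nonneg N
    have h5 := abs_nonneg C
    exact abs_le.2 ⟨le_min (by linarith) (by linarith),
      (min_le_right _ _).trans (by linarith [le_abs_self N])⟩
  exact ⟨hLN, hb, integral_lipschitz_le_of_noise (continuous_of_sub_le_sqrt hLN) hb hLN hU hUhalf hU1
    fun x hx => (min_le_left _ _).trans (hgood x hx)⟩

theorem measure_lt_le_of_noise {n : ℕ} {G U : (Fin n → ℝ) → ℝ} {C : ℝ} (hC : ∀ x, -C ≤ G x)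
    (hL : ∀ x y, G x - G y ≤ √(∑ i, (x i - y i) ^ 2))
    (hU : Integrable U (Measure.pi fun _ : Fin n => gaussianReal 0 1)) (hUhalf : ∀ x, 1 / 2 ≤ U x)
    (hU1 : ∫ x, U x ∂(Measure.pi fun _ : Fin n => gaussianReal 0 1) ≤ 1)
    (hgood : ∀ x, U x ≤ 32 → G x ≤ -(√(Real.log 2) *
      (4 - √(8 / 3 * max 1 (1 + Real.log (U x) / Real.log 2))))) {t : ℝ} (ht : 0 ≤ t) :
    (Measure.pi fun _ : Fin n => gaussianReal 0 1) {x | t < G x} ≤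
      ENNReal.ofReal (1 - stdPhi t) := by
  obtain ⟨hLN, hb, hint⟩ := integral_min_le_of_noise hC hL hU hUhalf hU1 hgood (t + 1)
  refine (measure_mono ?_).trans
    (measure_lt_le_of_integral_le (continuous_of_sub_le_sqrt hLN) hb hLN hint ht)
  exact fun x (hx : t < G x) => lt_min hx (lt_add_one t)

theorem lintegral_le_of_noise {n : ℕ} {G U : (Fin n → ℝ) → ℝ} {r c : ℝ} (hr : 0 ≤ r) (hc : 0 < c)
    (hF : ∀ x, 0 ≤ r + c * G x) (hL : ∀ x y, G x - G y ≤ √(∑ i, (x i - y i) ^ 2))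
    (hU : Integrable U (Measure.pi fun _ : Fin n => gaussianReal 0 1)) (hUhalf : ∀ x, 1 / 2 ≤ U x)
    (hU1 : ∫ x, U x ∂(Measure.pi fun _ : Fin n => gaussianReal 0 1) ≤ 1)
    (hgood : ∀ x, U x ≤ 32 → G x ≤ -(√(Real.log 2) *
      (4 - √(8 / 3 * max 1 (1 + Real.log (U x) / Real.log 2))))) :
    ∫⁻ x, ENNReal.ofReal (r + c * G x) ∂(Measure.pi fun _ : Fin n => gaussianReal 0 1) ≤
      ENNReal.ofReal r := by
  set γ := Measure.pi fun _ : Fin n => gaussianReal 0 1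
  have hC : ∀ x, -(r / c) ≤ G x := fun x => by
    rw [← neg_div, div_le_iff₀ hc]
    linarith [hF x]
  have hG := continuous_of_sub_le_sqrt hL
  calc ∫⁻ x, ENNReal.ofReal (r + c * G x) ∂γ
      ≤ ∫⁻ x, ⨆ N : ℕ, ENNReal.ofReal (r + c * min (G x) N) ∂γ := by
        refine lintegral_mono fun x => ?_
        obtain ⟨N, hN⟩ := exists_nat_ge (G x)
        refine le_trans (le_of_eq ?_) (le_iSup _ N)
        rw [min_eq_left hN]
    _ = ⨆ N : ℕ, ∫⁻ x, ENNReal.ofReal (r + c * min (G x) N) ∂γ := by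
        refine lintegral_iSup (fun N => ?_) fun N M hNM x => ?_
        · exact (ENNReal.continuous_ofReal.comp (by fun_prop)).measurable
        · have : (N : ℝ) ≤ M := by exact_mod_cast hNM
          dsimp only
          gcongr
    _ ≤ ENNReal.ofReal r := by
        refine iSup_le fun N => ?_
        obtain ⟨-, hb, hint⟩ := integral_min_le_of_noise hC hL hU hUhalf hU1 hgood N
        have hYi : Integrable (fun x => min (G x) (N : ℝ)) γ :=
          integrable_of_bounded (by fun_prop) hb
        have hnn : ∀ x, 0 ≤ r + c * min (G x) N := fun x => by
          rcases min_choice (G x) (N : ℝ) with h | h <;> rw [h]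
          · exact hF x
          · positivity
        have hi : Integrable (fun x => r + c * min (G x) (N : ℝ)) γ :=
          (integrable_const r).add (hYi.const_mul c)
        rw [← ofReal_integral_eq_lintegral_ofReal hi
          (Filter.Eventually.of_forall hnn), integral_add (integrable_const r) (hYi.const_mul c),
          integral_const_mul, integral_const, probReal_univ, one_smul]
        refine ENNReal.ofReal_le_ofReal ?_
        nlinarith

theorem sum_noise_mul_mulVec_le {n p : ℕ} {σ : ℝ} (hσ : 0 ≤ σ) (X : Matrix (Fin n) (Fin p) ℝ)
    (z : Fin n → ℝ) (u : Fin p → ℝ) :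
    (∑ i, (σ • z) i * X.mulVec u i) / n ≤
      √(8 / 3 * max 1 (1 + Real.log ((∑ j, Real.exp (3 / 8 * (∑ i, X i j / √n * z i) ^ 2)) /
        (2 * p)) / Real.log 2)) * slopeNorm σ n u := by
  refine le_trans (le_of_eq ?_) (sum_mul_le_slopeNorm hσ n (fun j => ∑ i, X i j / √n * z i) u)
  have h : (n : ℝ) = √n * √n := (Real.mul_self_sqrt (Nat.cast_nonneg n)).symm
  simp_rw [Matrix.mulVec, dotProduct, Finset.mul_sum, Finset.sum_mul, Finset.mul_sum]
  rw [Finset.sum_comm, Finset.sum_div]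
  refine Finset.sum_congr rfl fun j _ => ?_
  rw [Finset.sum_div]
  refine Finset.sum_congr rfl fun i _ => ?_
  nth_rewrite 1 [h]
  rw [Pi.smul_apply, smul_eq_mul]
  ring

theorem prediction_error_sub_le {n p : ℕ} (hn : 0 < n) {σ : ℝ} (hσ : 0 < σ) {f : Fin n → ℝ}
    {X : Matrix (Fin n) (Fin p) ℝ} {A : ℝ} (hA : 0 ≤ A) {βhat : (Fin n → ℝ) → (Fin p → ℝ)}
    (hmin : ∀ (y : Fin n → ℝ) (b : Fin p → ℝ),
      scaledNorm (y - X.mulVec (βhat y)) ^ 2 + 2 * A * slopeNorm σ n (βhat y)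
        ≤ scaledNorm (y - X.mulVec b) ^ 2 + 2 * A * slopeNorm σ n b) (z z' : Fin n → ℝ) :
    scaledNorm (X.mulVec (βhat (f + σ • z)) - f) - scaledNorm (X.mulVec (βhat (f + σ • z')) - f) ≤
      σ / √n * √(∑ i, (z i - z' i) ^ 2) := by
  refine (scaledNorm_sub_scaledNorm_le _ _).trans ?_
  have h1 := sum_sq_prediction_sub_le hσ.le hA hn (hmin (f + σ • z)) (hmin (f + σ • z'))
  have h2 : ∑ i, ((f + σ • z) i - (f + σ • z') i) ^ 2 = σ ^ 2 * ∑ i, (z i - z' i) ^ 2 := by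
    rw [Finset.mul_sum]
    refine Finset.sum_congr rfl fun i _ => ?_
    simp only [Pi.add_apply, Pi.smul_apply, smul_eq_mul]
    ring
  rw [h2] at h1
  rw [div_mul_eq_mul_div]
  gcongr
  have h3 : √(σ ^ 2 * ∑ i, (z i - z' i) ^ 2) = σ * √(∑ i, (z i - z' i) ^ 2) := by
    rw [Real.sqrt_mul (sq_nonneg σ), Real.sqrt_sq hσ.le]
  rw [← h3]
  refine Real.sqrt_le_sqrt (le_trans (le_of_eq ?_) h1)
  exact Finset.sum_congr rfl fun i _ => by simp only [Pi.sub_apply]; ring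

theorem ofReal_prediction_error_le {n p : ℕ} (hn : 0 < n) {σ : ℝ} (hσ : 0 < σ) {f ξ : Fin n → ℝ}
    {X : Matrix (Fin n) (Fin p) ℝ} (hdiag : ∀ j : Fin p, (1 / n) * ∑ i, X i j ^ 2 ≤ 1)
    {A : ℝ} (hA : 8 ≤ A) {b : Fin p → ℝ}
    (hb : ∀ v : Fin p → ℝ, scaledNorm (f + ξ - X.mulVec b) ^ 2 + 2 * A * slopeNorm σ n b
        ≤ scaledNorm (f + ξ - X.mulVec v) ^ 2 + 2 * A * slopeNorm σ n v)
    {κ : ℝ} (hκ0 : 0 ≤ κ) (hκ : κ ≤ 4)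
    (hξ : ∀ u : Fin p → ℝ, (∑ i, ξ i * X.mulVec u i) / n ≤ κ * slopeNorm σ n u)
    {s : ℕ} (hs1 : 1 ≤ s) (hs : s ≤ p) {β : Fin p → ℝ} (hβ : {j | β j ≠ 0}.ncard ≤ s) :
    ENNReal.ofReal (scaledNorm (X.mulVec b - f) + √(Real.log 2) * (4 - κ) * (σ / √n)) ≤
      ENNReal.ofReal (scaledNorm (X.mulVec β - f)) +
        ENNReal.ofReal (3 * σ * A * √(s * Real.log (2 * Real.exp 1 * p / s) / n)) /
          ENNReal.ofReal (2 * √(thetaSq X σ s 3)) := by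
  rcases le_or_gt (thetaSq X σ s 3) 0 with hθ | hθ
  · have hs0 : (0 : ℝ) < s := by exact_mod_cast hs1
    have hsp : (s : ℝ) ≤ p := by exact_mod_cast hs
    have hn' : (0 : ℝ) < n := by exact_mod_cast hn
    have hlog : 0 < Real.log (2 * Real.exp 1 * p / s) := by
      refine Real.log_pos ?_
      rw [one_lt_div hs0]
      nlinarith [Real.add_one_le_exp (1 : ℝ)]
    rw [Real.sqrt_eq_zero_of_nonpos hθ, mul_zero, ENNReal.ofReal_zero, ENNReal.div_zero, add_top]
    · exact le_top
    · exact (ENNReal.ofReal_pos.2 (by positivity)).ne'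
  · have hϑ : 0 < √(thetaSq X σ s 3) := Real.sqrt_pos.2 hθ
    rw [← ENNReal.ofReal_div_of_pos (by positivity),
      ← ENNReal.ofReal_add (scaledNorm_nonneg _) (by positivity)]
    have := prediction_error_le hσ hdiag hA hb hκ0 hκ hξ hs1 hs hβ hθ
    exact ENNReal.ofReal_le_ofReal (by linarith)

/-- Oracle inequalities in probability (at any level `1-δ`, with `q = Φ⁻¹(1-δ)`)
and in expectation for the SLOPE estimator.  The oracle bound (with the convention
`a/0 = +∞`) is expressed in `ℝ≥0∞`. -/
theorem stmt19 (n p : ℕ) (hn : 0 < n) (σ : ℝ) (hσ : 0 < σ) (f : Fin n → ℝ)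
    (X : Matrix (Fin n) (Fin p) ℝ)
    (hdiag : ∀ j : Fin p, (1 / n) * ∑ i, X i j ^ 2 ≤ 1)
    (A : ℝ) (hA : 8 ≤ A)
    (βhat : (Fin n → ℝ) → (Fin p → ℝ))
    (hmin : ∀ (y : Fin n → ℝ) (b : Fin p → ℝ),
      scaledNorm (y - X.mulVec (βhat y)) ^ 2 + 2 * A * slopeNorm σ n (βhat y)
        ≤ scaledNorm (y - X.mulVec b) ^ 2 + 2 * A * slopeNorm σ n b)
    (δ : ℝ) (hδ0 : 0 < δ) (hδ1 : δ < 1)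
    (q : ℝ) (hq : stdPhi q = 1 - δ) :
    (gaussianVec n σ
        {ξ | ENNReal.ofReal (scaledNorm (X.mulVec (βhat (f + ξ)) - f))
          ≤ (⨅ (s : ℕ) (_ : 1 ≤ s) (_ : s ≤ p) (β : Fin p → ℝ)
                (_ : {j | β j ≠ 0}.ncard ≤ s),
              (ENNReal.ofReal (scaledNorm (X.mulVec β - f)) +
                ENNReal.ofReal (3 * σ * A *
                    Real.sqrt (s * Real.log (2 * Real.exp 1 * p / s) / n)) /
                  ENNReal.ofReal (2 * Real.sqrt (thetaSq X σ s 3))))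
            + ENNReal.ofReal (σ * q / Real.sqrt n)}
      ≥ 1 - ENNReal.ofReal δ) ∧
    (∫⁻ ξ, ENNReal.ofReal (scaledNorm (X.mulVec (βhat (f + ξ)) - f)) ∂(gaussianVec n σ)
      ≤ (⨅ (s : ℕ) (_ : 1 ≤ s) (_ : s ≤ p) (β : Fin p → ℝ)
            (_ : {j | β j ≠ 0}.ncard ≤ s),
          (ENNReal.ofReal (scaledNorm (X.mulVec β - f)) +
            ENNReal.ofReal (3 * σ * A *
                Real.sqrt (s * Real.log (2 * Real.exp 1 * p / s) / n)) /
              ENNReal.ofReal (2 * Real.sqrt (thetaSq X σ s 3))))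
        + ENNReal.ofReal (σ / Real.sqrt (2 * Real.pi * n))) := by
  set R : ℝ≥0∞ := ⨅ (s : ℕ) (_ : 1 ≤ s) (_ : s ≤ p) (β : Fin p → ℝ)
      (_ : {j | β j ≠ 0}.ncard ≤ s),
    (ENNReal.ofReal (scaledNorm (X.mulVec β - f)) +
      ENNReal.ofReal (3 * σ * A *
          Real.sqrt (s * Real.log (2 * Real.exp 1 * p / s) / n)) /
        ENNReal.ofReal (2 * Real.sqrt (thetaSq X σ s 3)))
  have hprob : IsProbabilityMeasure (gaussianVec n σ) := by
    rw [gaussianVec_eq_map]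
    exact Measure.isProbabilityMeasure_map (by fun_prop)
  by_cases htop : R = ⊤
  · simp [htop]
  have hp : 0 < p := by
    by_contra hp0
    refine htop (top_le_iff.1 (le_iInf fun s => le_iInf fun hs1 => le_iInf fun hs => ?_))
    omega
  obtain ⟨r, hr0, hRr⟩ : ∃ r : ℝ, 0 ≤ r ∧ R = ENNReal.ofReal r :=
    ⟨R.toReal, ENNReal.toReal_nonneg, (ENNReal.ofReal_toReal htop).symm⟩
  have hn' : (0 : ℝ) < n := by exact_mod_cast hn
  set c := σ / √n with hc
  have hc0 : 0 < c := by positivity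
  have hcol : ∀ j, ∑ i, (X i j / √n) ^ 2 ≤ 1 := fun j => by
    simp_rw [div_pow, Real.sq_sqrt hn'.le]
    rw [← Finset.sum_div, ← one_div_mul_eq_div]
    exact hdiag j
  obtain ⟨hU, hU1, hUhalf⟩ := normalized_exp_sq_moment hp hcol
  set γ := Measure.pi fun _ : Fin n => gaussianReal 0 1
  set U : (Fin n → ℝ) → ℝ := fun z =>
    (∑ j, Real.exp (3 / 8 * (∑ i, X i j / √n * z i) ^ 2)) / (2 * p)
  set G : (Fin n → ℝ) → ℝ := fun z => (scaledNorm (X.mulVec (βhat (f + σ • z)) - f) - r) / c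
  have hFG : ∀ z, scaledNorm (X.mulVec (βhat (f + σ • z)) - f) = r + c * G z := fun z => by
    simp only [G]
    field_simp
    ring
  have hF0 : ∀ z, 0 ≤ r + c * G z := fun z => hFG z ▸ scaledNorm_nonneg _
  have hL : ∀ z z', G z - G z' ≤ √(∑ i, (z i - z' i) ^ 2) := fun z z' => by
    have h := prediction_error_sub_le hn hσ (by linarith : 0 ≤ A) hmin (f := f) z z'
    rw [hFG, hFG] at h
    refine le_of_mul_le_mul_left ?_ hc0
    linarith
  have hgood : ∀ z, U z ≤ 32 → G z ≤ -(√(Real.log 2) *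
      (4 - √(8 / 3 * max 1 (1 + Real.log (U z) / Real.log 2)))) := fun z hz => by
    have hlog2 : 0 < Real.log 2 := Real.log_pos one_lt_two
    have hκ : √(8 / 3 * max 1 (1 + Real.log (U z) / Real.log 2)) ≤ 4 := by
      refine Real.sqrt_le_iff.2 ⟨by norm_num, ?_⟩
      have h1 : Real.log (U z) / Real.log 2 ≤ 5 := by
        rw [div_le_iff₀ hlog2, show (5 : ℝ) * Real.log 2 = Real.log (2 ^ 5) by
          rw [Real.log_pow]; norm_num]
        exact Real.log_le_log (by linarith [hUhalf z]) (by linarith)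
      have h2 : max 1 (1 + Real.log (U z) / Real.log 2) ≤ 6 :=
        max_le (by norm_num) (by linarith)
      linarith
    have h : ENNReal.ofReal (scaledNorm (X.mulVec (βhat (f + σ • z)) - f) + √(Real.log 2) *
        (4 - √(8 / 3 * max 1 (1 + Real.log (U z) / Real.log 2))) * (σ / √n)) ≤ R :=
      le_iInf fun s => le_iInf fun hs1 => le_iInf fun hs => le_iInf fun β => le_iInf fun hβ =>
        ofReal_prediction_error_le hn hσ hdiag hA (hmin (f + σ • z)) (Real.sqrt_nonneg _) hκ
          (sum_noise_mul_mulVec_le hσ.le X z) hs1 hs hβ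
    rw [hRr, ENNReal.ofReal_le_ofReal_iff hr0, hFG] at h
    refine le_of_mul_le_mul_left ?_ hc0
    linarith
  have hC : ∀ z, -(r / c) ≤ G z := fun z => by
    rw [← neg_div, div_le_iff₀ hc0]
    linarith [hF0 z]
  have hmeas : AEMeasurable (fun z : Fin n → ℝ => σ • z) γ := by fun_prop
  constructor
  · set t := max q 0 with ht
    have hbad := measure_lt_le_of_noise hC hL hU hUhalf hU1 hgood (le_max_right q 0)
    have hδ : 1 - stdPhi t ≤ δ := by
      have := stdPhi_mono (le_max_left q 0)
      linarith
    have hG : MeasurableSet {z | t < G z} :=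
      measurableSet_lt measurable_const (continuous_of_sub_le_sqrt hL).measurable
    have hsub : {z | t < G z}ᶜ ⊆ (fun z : Fin n → ℝ => σ • z) ⁻¹'
        {ξ | ENNReal.ofReal (scaledNorm (X.mulVec (βhat (f + ξ)) - f)) ≤
          R + ENNReal.ofReal (σ * q / √n)} := by
      intro z hz
      have hz' : G z ≤ t := not_lt.1 hz
      rw [Set.mem_preimage, Set.mem_ofPred_eq, hFG, hRr]
      have h1 : ENNReal.ofReal (σ * q / √n) = ENNReal.ofReal (c * t) := by
        rw [hc, div_mul_eq_mul_div]
        rcases le_total q 0 with hq0 | hq0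
        · rw [ht, max_eq_right hq0, mul_zero, zero_div, ENNReal.ofReal_zero]
          exact ENNReal.ofReal_of_nonpos
            (div_nonpos_of_nonpos_of_nonneg (mul_nonpos_of_nonneg_of_nonpos hσ.le hq0)
              (Real.sqrt_nonneg _))
        · rw [ht, max_eq_left hq0]
      rw [h1, ← ENNReal.ofReal_add hr0 (mul_nonneg hc0.le (le_max_right q 0))]
      exact ENNReal.ofReal_le_ofReal (by gcongr)
    rw [gaussianVec_eq_map]
    calc 1 - ENNReal.ofReal δ ≤ 1 - γ {z | t < G z} :=
          tsub_le_tsub_left (hbad.trans (ENNReal.ofReal_le_ofReal hδ)) 1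
      _ = γ {z | t < G z}ᶜ := (prob_compl_eq_one_sub hG).symm
      _ ≤ _ := measure_mono hsub
      _ ≤ _ := Measure.le_map_apply hmeas _
  · rw [gaussianVec_eq_map]
    refine ((lintegral_map_le _ _).trans ?_).trans le_self_add
    simp_rw [hFG]
    rw [hRr]
    exact lintegral_le_of_noise hr0 hc0 hF0 hL hU hUhalf hU1 hgood
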